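/- arXiv:1504.01283 — 2 statements merged into one kernel-verified Lean document; each statement's English description precedes it below -/
import Mathlib

section
/- Let χ be a character of S_n and let B be a finite set equipped with a map Des: B → 2^{[n−1]}. Then χ(α) = Σ_{b ∈ B, Des(b) α-unimodal} (−1)^{|Des(b) \ S(α)|} for every composition α of n if and only if the Frobenius characteristic of χ equals Σ_{b ∈ B} F_{n, Des(b)}(x). -/
open Finset Classical

/-- The coefficient of the monomial `m` in the Schur function `s_μ`. -/
noncomputable def schurCoeff (μ : YoungDiagram) (m : ℕ →₀ ℕ) : ℕ :=
  Set.ncard { T : SemistandardYoungTableau μ |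
    (∑ c ∈ μ.cells, Finsupp.single (T c.1 c.2) 1) = m }

/-- The coefficient of the monomial `m` in the power sum symmetric function `p_α`. -/
noncomputable def powerSumCoeff (α : List ℕ) (m : ℕ →₀ ℕ) : ℤ :=
  (Set.ncard { g : Fin α.length → ℕ |
    (∑ j, Finsupp.single (g j) (α.get j)) = m } : ℤ)

/-- The coefficient of the monomial `m` in the fundamental quasisymmetric function
`F_{n,S}(x)`. -/
noncomputable def fqsymCoeff (n : ℕ) (S : Set ℕ) (m : ℕ →₀ ℕ) : ℕ :=
  Set.ncard { f : Fin n → ℕ |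
    Monotone f ∧
    (∀ j k : Fin n, (j : ℕ) + 1 = (k : ℕ) → ((j : ℕ) + 1) ∈ S → f j < f k) ∧
    (∑ j, Finsupp.single (f j) 1) = m }

/-- The set `S(α)` of partial sums of a composition `α`. -/
def partialSums (α : List ℕ) : Set ℕ :=
  { s | ∃ i < α.length, s = (α.take (i + 1)).sum }

/-- `α`-unimodality of a subset of `[n-1]`. -/
def AlphaUnimodal (α : List ℕ) (S : Set ℕ) : Prop :=
  ∀ j k : ℕ, j < k → k ∈ S →
    (∃ i < α.length, (α.take i).sum < j ∧ k < (α.take (i + 1)).sum) → j ∈ S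

/-- A square matrix that is upper unitriangular with respect to a weight `r` on its indices. -/
def Matrix.IsUnitri {ι A : Type*} [LinearOrder A] (r : ι → A) (M : Matrix ι ι ℚ) : Prop :=
  (∀ i, M i i = 1) ∧ ∀ i j, i ≠ j → M i j ≠ 0 → r i < r j

theorem Matrix.det_ne_zero_of_triangular {ι A : Type*} [Fintype ι] [DecidableEq ι] [LinearOrder A]
    (r : ι → A) (M : Matrix ι ι ℚ) (hd : ∀ i, M i i ≠ 0)
    (ht : ∀ i j, i ≠ j → M i j ≠ 0 → r i < r j) : M.det ≠ 0 := by
  intro h0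
  obtain ⟨x, hx, hMx⟩ := Matrix.exists_mulVec_eq_zero_iff.mpr h0
  have hne : (univ.filter fun i => x i ≠ 0).Nonempty := by
    by_contra hc
    rw [Finset.not_nonempty_iff_eq_empty, Finset.filter_eq_empty_iff] at hc
    exact hx (funext fun i => by simpa using hc (mem_univ i))
  obtain ⟨i, hi, hmax⟩ := Finset.exists_max_image _ r hne
  have hi' : x i ≠ 0 := (mem_filter.mp hi).2
  have h1 := congrFun hMx i
  rw [Matrix.mulVec, dotProduct, Finset.sum_eq_single i] at h1
  · exact mul_ne_zero (hd i) hi' h1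
  · intro j _ hji
    by_contra hne
    have hM := left_ne_zero_of_mul hne
    have hxj := right_ne_zero_of_mul hne
    exact absurd (ht i j hji.symm hM) (not_lt.mpr (hmax j (by simpa using hxj)))
  · simp

theorem Matrix.IsUnitri.det_ne_zero {ι A : Type*} [Fintype ι] [DecidableEq ι] [LinearOrder A]
    {r : ι → A} {M : Matrix ι ι ℚ} (hM : M.IsUnitri r) : M.det ≠ 0 :=
  Matrix.det_ne_zero_of_triangular r M (fun i => by simp [hM.1 i]) hM.2

/-- The solution of a unitriangular system with unitriangular right-hand side is unitriangular. -/
theorem Matrix.IsUnitri.of_mul_eq {ι A : Type*} [Fintype ι] [LinearOrder A]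
    {r : ι → A} {D Y N : Matrix ι ι ℚ} (hD : D.IsUnitri r) (hN : N.IsUnitri r)
    (h : D * Y = N) : Y.IsUnitri r := by
  have expand : ∀ i j, Y i j = N i j - ∑ k ∈ univ.erase i, D i k * Y k j := by
    intro i j
    have := congrFun (congrFun h i) j
    rw [Matrix.mul_apply, ← Finset.add_sum_erase _ _ (mem_univ i), hD.1 i] at this
    linarith
  have off : ∀ i j, i ≠ j → Y i j ≠ 0 → r i < r j := by
    by_contra! hc
    let s : Finset (ι × ι) := univ.filter fun p => p.1 ≠ p.2 ∧ Y p.1 p.2 ≠ 0 ∧ r p.2 ≤ r p.1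
    obtain ⟨i, j, h1, h2, h3⟩ := hc
    obtain ⟨⟨i, j⟩, hp, hmax⟩ := Finset.exists_max_image s (fun p => r p.1)
      ⟨(i, j), by simp [s, h1, h2, h3]⟩
    obtain ⟨hij, hY, hr⟩ : i ≠ j ∧ Y i j ≠ 0 ∧ r j ≤ r i := by simpa [s] using hp
    apply hY
    rw [expand i j]
    have hN0 : N i j = 0 := by
      by_contra hne
      exact absurd (hN.2 i j hij hne) (not_lt.mpr hr)
    rw [hN0, Finset.sum_eq_zero, sub_zero]
    intro k hk
    by_contra hne
    have hDik := hD.2 i k (Finset.ne_of_mem_erase hk).symm (left_ne_zero_of_mul hne)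
    have hkj : k ≠ j := by rintro rfl; exact absurd hDik (not_lt.mpr hr)
    have := hmax (k, j) (by
      simp only [s, mem_filter, mem_univ, true_and]
      exact ⟨hkj, right_ne_zero_of_mul hne, hr.trans hDik.le⟩)
    exact absurd hDik (not_lt.mpr this)
  refine ⟨fun i => ?_, off⟩
  rw [expand i i, hN.1, Finset.sum_eq_zero, sub_zero]
  intro k hk
  by_contra hne
  have hki := Finset.ne_of_mem_erase hk
  exact absurd (hD.2 i k hki.symm (left_ne_zero_of_mul hne))
    (not_lt.mpr (off k i hki (right_ne_zero_of_mul hne)).le)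

theorem Matrix.IsUnitri.transpose {ι A : Type*} [LinearOrder A]
    {r : ι → A} {M : Matrix ι ι ℚ} (hM : M.IsUnitri r) :
    M.transpose.IsUnitri (fun i => OrderDual.toDual (r i)) :=
  ⟨hM.1, fun i j hij h => hM.2 j i hij.symm h⟩

/-- Uniqueness of the unitriangular factorization of a symmetric matrix. -/
theorem Matrix.IsUnitri.eq_of_transpose_mul_eq {ι A : Type*} [Fintype ι] [DecidableEq ι]
    [LinearOrder A] {r : ι → A} {K Y : Matrix ι ι ℚ} (hK : K.IsUnitri r) (hY : Y.IsUnitri r)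
    (h : Y.transpose * K = K.transpose * Y) : Y = K := by
  have hKu : IsUnit K.det := isUnit_iff_ne_zero.mpr hK.det_ne_zero
  have hKtu : IsUnit K.transpose.det := by rwa [Matrix.det_transpose]
  have hG : Y * K⁻¹ = (Y * K⁻¹).transpose := by
    have h2 : (Y * K⁻¹).transpose = K.transpose⁻¹ * Y.transpose := by
      rw [Matrix.transpose_mul, Matrix.transpose_nonsing_inv]
    rw [h2]
    calc Y * K⁻¹ = K.transpose⁻¹ * (K.transpose * Y) * K⁻¹ := by
          rw [Matrix.nonsing_inv_mul_cancel_left _ _ hKtu]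
      _ = K.transpose⁻¹ * (Y.transpose * K) * K⁻¹ := by rw [h]
      _ = K.transpose⁻¹ * Y.transpose := by
          rw [Matrix.mul_assoc, Matrix.mul_nonsing_inv_cancel_right _ _ hKu]
  set G := Y * K⁻¹ with hGdef
  have hGK : G * K = Y := Matrix.nonsing_inv_mul_cancel_right _ _ hKu
  have hGt : G.IsUnitri (fun i => OrderDual.toDual (r i)) := by
    refine hK.transpose.of_mul_eq hY.transpose ?_
    rw [hG, ← Matrix.transpose_mul, hGK]
  have hG' : G.IsUnitri r := by
    rw [hG]; exact hGt.transpose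
  have : G = 1 := by
    ext i j
    by_cases hij : i = j
    · subst hij; simp [hG'.1]
    · rw [Matrix.one_apply_ne hij]
      by_contra hne
      exact lt_asymm (hG'.2 i j hij hne) (hGt.2 i j hij hne)
  rw [← hGK, this, Matrix.one_mul]

/-- The content of a word (or filling) `f`: the exponent vector counting each letter. -/
noncomputable def content {X : Type*} [Fintype X] (f : X → ℕ) : ℕ →₀ ℕ :=
  ∑ x, Finsupp.single (f x) 1

theorem content_apply {X : Type*} [Fintype X] (f : X → ℕ) (i : ℕ) :
    content f i = (univ.filter fun x => f x = i).card := by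
  rw [content, Finsupp.finsetSum_apply, Finset.card_filter]
  exact Finset.sum_congr rfl fun x _ => by rw [Finsupp.single_apply]

theorem content_comp_equiv {X Y : Type*} [Fintype X] [Fintype Y] (e : X ≃ Y) (f : Y → ℕ) :
    content (f ∘ e) = content f :=
  Equiv.sum_comp e fun y => Finsupp.single (f y) 1

theorem mem_support_content {X : Type*} [Fintype X] (f : X → ℕ) (x : X) :
    f x ∈ (content f).support := by
  rw [Finsupp.mem_support_iff, content_apply]
  exact Finset.card_ne_zero_of_mem (by simp : x ∈ _)

theorem sum_comp_eq_sum_content {X : Type*} [Fintype X] (f : X → ℕ) (w : ℕ → ℕ) :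
    ∑ x, w (f x) = (content f).sum fun i a => a * w i := by
  rw [content, ← Finsupp.sum_finsetSum_index (by simp) (by intros; ring)]
  exact Finset.sum_congr rfl fun x _ => by simp

theorem sum_comp_of_content_eq {X Y : Type*} [Fintype X] [Fintype Y] {f : X → ℕ} {g : Y → ℕ}
    (h : content f = content g) (w : ℕ → ℕ) : ∑ x, w (f x) = ∑ y, w (g y) := by
  rw [sum_comp_eq_sum_content, sum_comp_eq_sum_content, h]

theorem finite_content_eq {X : Type*} [Fintype X] (m : ℕ →₀ ℕ) :
    {f : X → ℕ | content f = m}.Finite := by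
  refine (Set.Finite.pi' fun _ : X => m.support.finite_toSet).subset ?_
  rintro f rfl x
  exact mem_support_content f x

/-- The set of positions `k` (counted from one) such that `R` holds between the entries of
index `k - 1` and `k` (counted from zero). -/
noncomputable def descentSet {n : ℕ} (R : Fin n → Fin n → Prop) : Finset ℕ :=
  (univ.filter fun k : Fin n => ∃ j : Fin n, (j : ℕ) + 1 = k ∧ R j k).map Fin.valEmbedding

theorem mem_descentSet {n : ℕ} {R : Fin n → Fin n → Prop} {x : ℕ} :
    x ∈ descentSet R ↔ ∃ j k : Fin n, (j : ℕ) + 1 = k ∧ R j k ∧ (k : ℕ) = x := by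
  simp only [descentSet, mem_map, mem_filter, mem_univ, true_and, Fin.valEmbedding_apply]
  constructor
  · rintro ⟨k, ⟨j, h, hR⟩, rfl⟩; exact ⟨j, k, h, hR, rfl⟩
  · rintro ⟨j, k, h, hR, rfl⟩; exact ⟨k, ⟨j, h, hR⟩, rfl⟩

theorem succ_mem_descentSet {n : ℕ} {R : Fin n → Fin n → Prop} {j k : Fin n}
    (h : (j : ℕ) + 1 = k) : (j : ℕ) + 1 ∈ descentSet R ↔ R j k := by
  rw [mem_descentSet]
  constructor
  · rintro ⟨j', k', h', hR, hk⟩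
    obtain rfl : k' = k := Fin.ext (by omega)
    obtain rfl : j' = j := Fin.ext (by omega)
    exact hR
  · exact fun hR => ⟨j, k, h, hR, h.symm⟩

theorem descentSet_subset {n : ℕ} (R : Fin n → Fin n → Prop) :
    descentSet R ⊆ Icc 1 (n - 1) := by
  intro x hx
  obtain ⟨j, k, h, -, rfl⟩ := mem_descentSet.mp hx
  have := k.2
  rw [mem_Icc]; omega

theorem descentSet_congr {n : ℕ} {R R' : Fin n → Fin n → Prop}
    (h : ∀ j k : Fin n, (j : ℕ) + 1 = k → (R j k ↔ R' j k)) : descentSet R = descentSet R' := by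
  ext x
  rw [mem_descentSet, mem_descentSet]
  exact exists_congr fun j => exists_congr fun k => and_congr_right fun hjk =>
    and_congr_left fun _ => h j k hjk

theorem sdiff_descentSet {n : ℕ} (R : Fin n → Fin n → Prop) :
    Icc 1 (n - 1) \ descentSet R = descentSet fun j k => ¬ R j k := by
  ext x
  rw [mem_sdiff, mem_Icc]
  constructor
  · rintro ⟨⟨h1, h2⟩, hx⟩
    refine mem_descentSet.mpr ⟨⟨x - 1, by omega⟩, ⟨x, by omega⟩, by simp; omega, fun hR => hx ?_, rfl⟩
    exact mem_descentSet.mpr ⟨_, _, by simp; omega, hR, rfl⟩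
  · intro hx
    refine ⟨mem_Icc.mp (descentSet_subset _ hx), fun hx' => ?_⟩
    obtain ⟨j, k, h, hR, rfl⟩ := mem_descentSet.mp hx
    rw [← h] at hx'
    exact hR ((succ_mem_descentSet h).mp hx')

theorem fqsymCoeff_eq_ncard (n : ℕ) (S : Set ℕ) (m : ℕ →₀ ℕ) :
    fqsymCoeff n S m = Set.ncard {f : Fin n → ℕ | Monotone f ∧
      (∀ j k : Fin n, (j : ℕ) + 1 = (k : ℕ) → ((j : ℕ) + 1) ∈ S → f j < f k) ∧ content f = m} :=
  rfl

theorem strictMono_of_lt_of_succ {n : ℕ} {β : Type*} [Preorder β] {f : Fin n → β}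
    (h : ∀ j k : Fin n, (j : ℕ) + 1 = k → f j < f k) : StrictMono f := by
  cases n with
  | zero => exact fun i => i.elim0
  | succ n => exact Fin.strictMono_iff_lt_succ.mpr fun i => h _ _ (by simp)

theorem monotone_of_le_of_succ {n : ℕ} {β : Type*} [Preorder β] {f : Fin n → β}
    (h : ∀ j k : Fin n, (j : ℕ) + 1 = k → f j ≤ f k) : Monotone f := by
  cases n with
  | zero => exact fun i => i.elim0
  | succ n => exact Fin.monotone_iff_le_succ.mpr fun i => h _ _ (by simp)

theorem lt_of_succ {n : ℕ} {j k : Fin n} (h : (j : ℕ) + 1 = k) : j < k := by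
  rw [Fin.lt_def]; omega

/-- A pair of sequences is lexicographically increasing iff the first one is increasing, strictly
so wherever the second one does not increase. -/
theorem strictMono_toLex_iff {n : ℕ} {β : Type*} [LinearOrder β] (f : Fin n → ℕ) (g : Fin n → β) :
    StrictMono (fun k => toLex (f k, g k)) ↔ Monotone f ∧
      ∀ j k : Fin n, (j : ℕ) + 1 = k → (j : ℕ) + 1 ∈ (descentSet fun j k => g k ≤ g j : Set ℕ) →
        f j < f k := by
  constructor
  · intro h
    have hm : ∀ j k, j < k → f j < f k ∨ f j = f k ∧ g j < g k := fun j k hjk => by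
      simpa [Prod.Lex.toLex_lt_toLex] using h hjk
    refine ⟨monotone_of_le_of_succ fun j k hjk => ?_, fun j k hjk hd => ?_⟩
    · rcases hm j k (lt_of_succ hjk) with h1 | h1
      exacts [h1.le, h1.1.le]
    · rw [mem_coe, succ_mem_descentSet hjk] at hd
      rcases hm j k (lt_of_succ hjk) with h1 | h1
      exacts [h1, absurd h1.2 (not_lt.mpr hd)]
  · rintro ⟨hf, hs⟩
    refine strictMono_of_lt_of_succ fun j k hjk => ?_
    rw [Prod.Lex.toLex_lt_toLex]
    by_cases hd : g k ≤ g j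
    · exact Or.inl (hs j k hjk (by rwa [mem_coe, succ_mem_descentSet hjk]))
    · rcases (hf (lt_of_succ hjk).le).lt_or_eq with h1 | h1
      exacts [Or.inl h1, Or.inr ⟨h1, not_le.mp hd⟩]

/-- `e` lists the elements of `X` by increasing value of `T`, ties being broken by `col`. -/
def IsStandardization {n : ℕ} {X β : Type*} [LinearOrder β] (col : X → β) (T : X → ℕ)
    (e : Fin n ≃ X) : Prop :=
  StrictMono fun k => toLex (T (e k), col (e k))

theorem IsStandardization.unique {n : ℕ} {X β : Type*} [LinearOrder β] {col : X → β} {T : X → ℕ}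
    {e e' : Fin n ≃ X} (h : IsStandardization col T e) (h' : IsStandardization col T e') :
    e = e' := by
  let key : X → ℕ ×ₗ β := fun x => toLex (T x, col x)
  have hr : Set.range (key ∘ e) = Set.range (key ∘ e') := by
    rw [e.surjective.range_comp, e'.surjective.range_comp]
  have heq : key ∘ e = key ∘ e' := (StrictMono.range_inj h h').mp hr
  have hinj : Function.Injective key := by
    have h1 : Function.Injective (key ∘ e) := h.injective
    exact (Function.Injective.of_comp_iff' key e.bijective).mp h1
  exact Equiv.ext fun k => hinj (congrFun heq k)

theorem exists_isStandardization {n : ℕ} {X β : Type*} [Fintype X] [LinearOrder β] {col : X → β}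
    {T : X → ℕ} (hX : Fintype.card X = n) (hinj : ∀ x y, T x = T y → col x = col y → x = y) :
    ∃ e : Fin n ≃ X, IsStandardization col T e := by
  let key : X → ℕ ×ₗ β := fun x => toLex (T x, col x)
  have hkey : Function.Injective key := fun x y hxy => by
    have := Prod.ext_iff.mp (toLex.injective hxy)
    exact hinj x y this.1 this.2
  let s : Finset (ℕ ×ₗ β) := univ.map ⟨key, hkey⟩
  have hs : s.card = n := by simp [s, hX]
  let o := s.orderEmbOfFin hs
  have ho : ∀ k, ∃ x, key x = o k := fun k => by
    have hk : s.orderEmbOfFin hs k ∈ univ.map ⟨key, hkey⟩ := s.orderEmbOfFin_mem hs k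
    obtain ⟨x, -, hx⟩ := mem_map.mp hk
    exact ⟨x, hx⟩
  choose g hg using ho
  have hginj : Function.Injective g := fun a b hab => o.injective (by rw [← hg, ← hg, hab])
  have hgbij : Function.Bijective g :=
    (Fintype.bijective_iff_injective_and_card g).mpr ⟨hginj, by simp [hX]⟩
  refine ⟨Equiv.ofBijective g hgbij, ?_⟩
  have : (fun k => toLex (T (g k), col (g k))) = o := funext hg
  change StrictMono fun k => toLex (T (g k), col (g k))
  rw [this]
  exact o.strictMono

/-- Counting fillings by their standardization. -/
theorem ncard_eq_sum_fqsymCoeff {n : ℕ} {X β : Type*} [Fintype X] [LinearOrder β]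
    (col : X → β) (hX : Fintype.card X = n) (P : (X → ℕ) → Prop) (Q : (Fin n ≃ X) → Prop)
    (hinj : ∀ T, P T → ∀ x y, T x = T y → col x = col y → x = y)
    (hPQ : ∀ T e, IsStandardization col T e → (P T ↔ Q e)) (m : ℕ →₀ ℕ) :
    Set.ncard {T : X → ℕ | P T ∧ content T = m} =
      ∑ e : Fin n ≃ X with Q e,
        fqsymCoeff n ↑(descentSet fun j k => col (e k) ≤ col (e j)) m := by
  have hfin : {T : X → ℕ | P T ∧ content T = m}.Finite :=
    (finite_content_eq m).subset fun T h => h.2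
  have hterm : ∀ e : Fin n ≃ X,
      fqsymCoeff n ↑(descentSet fun j k => col (e k) ≤ col (e j)) m =
        (hfin.toFinset.filter fun T => IsStandardization col T e).card +
          if Q e then 0 else fqsymCoeff n ↑(descentSet fun j k => col (e k) ≤ col (e j)) m := by
    intro e
    by_cases hQ : Q e
    · rw [if_pos hQ, add_zero, fqsymCoeff_eq_ncard, ← Set.ncard_coe_finset]
      refine Set.ncard_congr (fun f _ => f ∘ e.symm) ?_ ?_ ?_
      · rintro f ⟨h1, h2, h3⟩
        have hs : IsStandardization col (f ∘ e.symm) e := by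
          have := (strictMono_toLex_iff f fun k => col (e k)).mpr ⟨h1, h2⟩
          simpa [IsStandardization] using this
        simp only [coe_filter, Set.Finite.mem_toFinset, Set.mem_ofPred_eq]
        exact ⟨⟨(hPQ _ e hs).mpr hQ, by rw [content_comp_equiv, h3]⟩, hs⟩
      · intro f g _ _ hfg
        exact e.symm.surjective.injective_comp_right hfg
      · intro T hT
        simp only [coe_filter, Set.Finite.mem_toFinset, Set.mem_ofPred_eq] at hT
        refine ⟨T ∘ e, ?_, by ext x; simp⟩
        have := (strictMono_toLex_iff (T ∘ e) fun k => col (e k)).mp hT.2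
        exact ⟨this.1, this.2, by rw [content_comp_equiv, hT.1.2]⟩
    · rw [if_neg hQ, Finset.card_eq_zero.mpr, zero_add]
      rw [Finset.filter_eq_empty_iff]
      intro T hT hs
      rw [Set.Finite.mem_toFinset] at hT
      exact hQ ((hPQ T e hs).mp hT.1)
  have hpart : hfin.toFinset.card =
      ∑ e : Fin n ≃ X, (hfin.toFinset.filter fun T => IsStandardization col T e).card := by
    rw [← Finset.card_biUnion]
    · congr 1
      ext T
      simp only [mem_biUnion, mem_univ, true_and, mem_filter]
      constructor
      · intro hT
        obtain ⟨e, he⟩ := exists_isStandardization hX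
          (hinj T ((Set.Finite.mem_toFinset hfin).mp hT).1)
        exact ⟨e, hT, he⟩
      · rintro ⟨e, hT, -⟩; exact hT
    · intro e _ e' _ hee
      rw [Function.onFun, Finset.disjoint_left]
      intro T h1 h2
      exact hee ((mem_filter.mp h1).2.unique (mem_filter.mp h2).2)
  rw [Set.ncard_eq_toFinset_card _ hfin, hpart, Finset.sum_filter]
  refine Finset.sum_congr rfl fun e _ => ?_
  have := hterm e
  by_cases hQ : Q e
  · rw [if_pos hQ] at this ⊢; omega
  · rw [if_neg hQ] at this ⊢; omega

/-- Semistandardness of a filling of the cells of `μ`. -/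
def IsSemistandard (μ : YoungDiagram) (T : μ.cells → ℕ) : Prop :=
  (∀ c c' : μ.cells, c.1.1 = c'.1.1 → c.1.2 < c'.1.2 → T c ≤ T c') ∧
    ∀ c c' : μ.cells, c.1.2 = c'.1.2 → c.1.1 < c'.1.1 → T c < T c'

theorem schurCoeff_eq_ncard (μ : YoungDiagram) (m : ℕ →₀ ℕ) :
    schurCoeff μ m = Set.ncard {T : μ.cells → ℕ | IsSemistandard μ T ∧ content T = m} := by
  have hcont : ∀ T : SemistandardYoungTableau μ, content (fun c : μ.cells => T c.1.1 c.1.2) =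
      ∑ c ∈ μ.cells, Finsupp.single (T c.1 c.2) 1 := fun T =>
    Finset.sum_coe_sort μ.cells fun c => Finsupp.single (T c.1 c.2) 1
  refine Set.ncard_congr (fun T _ c => T c.1.1 c.1.2) ?_ ?_ ?_
  · intro T hT
    refine ⟨⟨?_, ?_⟩, (hcont T).trans hT⟩
    · rintro ⟨⟨i, j⟩, h⟩ ⟨⟨i', j'⟩, h'⟩ rfl hj
      exact T.row_weak hj h'
    · rintro ⟨⟨i, j⟩, h⟩ ⟨⟨i', j'⟩, h'⟩ rfl hi
      exact T.col_strict hi h'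
  · intro T T' _ _ h
    ext i j
    by_cases hc : (i, j) ∈ μ
    · exact congrFun h ⟨(i, j), hc⟩
    · rw [T.zeros hc, T'.zeros hc]
  · rintro T ⟨⟨hr, hc⟩, hm⟩
    let T' : SemistandardYoungTableau μ :=
      { entry := fun i j => if h : (i, j) ∈ μ then T ⟨(i, j), h⟩ else 0
        row_weak' := by
          intro i j1 j2 hj h
          rw [dif_pos h, dif_pos (μ.up_left_mem le_rfl hj.le h)]
          exact hr _ _ rfl hj
        col_strict' := by
          intro i1 i2 j hi h
          rw [dif_pos h, dif_pos (μ.up_left_mem hi.le le_rfl h)]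
          exact hc _ _ rfl hi
        zeros' := fun {i j} h => dif_neg h }
    have hT' : (fun c : μ.cells => T' c.1.1 c.1.2) = T := funext fun c => dif_pos c.2
    refine ⟨T', ?_, hT'⟩
    rw [Set.mem_ofPred_eq, ← hcont, hT', hm]

theorem IsSemistandard.key_injective {μ : YoungDiagram} {T : μ.cells → ℕ}
    (hT : IsSemistandard μ T) (c c' : μ.cells) (h1 : T c = T c') (h2 : c.1.2 = c'.1.2) :
    c = c' := by
  refine Subtype.ext (Prod.ext ?_ h2)
  rcases lt_trichotomy c.1.1 c'.1.1 with h | h | h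
  · exact absurd h1 (hT.2 c c' h2 h).ne
  · exact h
  · exact absurd h1 (hT.2 c' c h2.symm h).ne'

theorem IsSemistandard.le_of_row_le {μ : YoungDiagram} {T : μ.cells → ℕ}
    (hT : IsSemistandard μ T) {c c' : μ.cells} (h : c.1.2 = c'.1.2) (h' : c.1.1 ≤ c'.1.1) :
    T c ≤ T c' := by
  rcases h'.lt_or_eq with h1 | h1
  · exact (hT.2 c c' h h1).le
  · rw [show c = c' from Subtype.ext (Prod.ext h1 h)]

/-- `e` lists the cells of `μ` in the order of a standard Young tableau. -/
def IsStandardListing {n : ℕ} (μ : YoungDiagram) (e : Fin n ≃ μ.cells) : Prop :=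
  ∀ c c' : μ.cells, c.1 ≤ c'.1 → e.symm c ≤ e.symm c'

theorem isSemistandard_iff_isStandardListing {n : ℕ} {μ : YoungDiagram} {T : μ.cells → ℕ}
    {e : Fin n ≃ μ.cells} (h : IsStandardization (fun c : μ.cells => c.1.2) T e) :
    IsSemistandard μ T ↔ IsStandardListing μ e := by
  have hlt : ∀ c c' : μ.cells, e.symm c < e.symm c' ↔ T c < T c' ∨ T c = T c' ∧ c.1.2 < c'.1.2 := by
    intro c c'
    have := h.lt_iff_lt (a := e.symm c) (b := e.symm c')
    simpa [Prod.Lex.toLex_lt_toLex] using this.symm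
  constructor
  · intro hT c c' hcc
    rcases eq_or_ne c c' with rfl | hne
    · exact le_rfl
    refine ((hlt c c').mpr ?_).le
    let z : μ.cells := ⟨(c.1.1, c'.1.2), μ.up_left_mem hcc.1 le_rfl c'.2⟩
    have hz' : T z ≤ T c' := hT.le_of_row_le (c := z) rfl hcc.1
    rcases hcc.2.lt_or_eq with h2 | h2
    · have hz : T c ≤ T z := hT.1 c z rfl h2
      rcases (hz.trans hz').lt_or_eq with h3 | h3
      exacts [Or.inl h3, Or.inr ⟨h3, h2⟩]
    · have h1 : c.1.1 < c'.1.1 :=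
        lt_of_le_of_ne hcc.1 fun h1 => hne (Subtype.ext (Prod.ext h1 h2))
      exact Or.inl (hT.2 c c' h2 h1)
  · intro he
    have hlt' : ∀ c c' : μ.cells, c.1 ≤ c'.1 → c ≠ c' →
        T c < T c' ∨ T c = T c' ∧ c.1.2 < c'.1.2 := fun c c' hcc hne =>
      (hlt c c').mp (lt_of_le_of_ne (he c c' hcc) (e.symm.injective.ne hne))
    constructor
    · intro c c' h1 h2
      rcases hlt' c c' ⟨h1.le, h2.le⟩ (fun hc => h2.ne (by rw [hc])) with h3 | h3
      exacts [h3.le, h3.1.le]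
    · intro c c' h1 h2
      rcases hlt' c c' ⟨h2.le, h1.le⟩ (fun hc => h2.ne (by rw [hc])) with h3 | h3
      exacts [h3, absurd h1 h3.2.ne]

/-- The expansion of Schur functions into fundamental quasisymmetric functions. -/
theorem schurCoeff_eq_sum_fqsymCoeff {n : ℕ} {μ : YoungDiagram} (hμ : μ.cells.card = n)
    (m : ℕ →₀ ℕ) :
    schurCoeff μ m = ∑ e : Fin n ≃ μ.cells with IsStandardListing μ e,
      fqsymCoeff n ↑(descentSet fun j k => (e k).1.2 ≤ (e j).1.2) m := by
  rw [schurCoeff_eq_ncard]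
  have := ncard_eq_sum_fqsymCoeff (fun c : μ.cells => c.1.2) (by simpa using hμ)
    (IsSemistandard μ) (IsStandardListing μ) (fun T hT => hT.key_injective)
    (fun T e => isSemistandard_iff_isStandardListing) m
  convert this

/-- Transposition of cells. -/
def transposeCells (μ : YoungDiagram) : μ.cells ≃ μ.transpose.cells where
  toFun c := ⟨c.1.swap, by
    rw [YoungDiagram.mem_cells, YoungDiagram.mem_transpose, Prod.swap_swap]; exact c.2⟩
  invFun c := ⟨c.1.swap, YoungDiagram.mem_transpose.mp c.2⟩
  left_inv _ := rfl
  right_inv _ := rfl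

theorem isStandardListing_transpose {n : ℕ} {μ : YoungDiagram} {e : Fin n ≃ μ.cells} :
    IsStandardListing μ.transpose (e.trans (transposeCells μ)) ↔ IsStandardListing μ e :=
  ⟨fun h c c' hc => by
      have := h (transposeCells μ c) (transposeCells μ c') ⟨hc.2, hc.1⟩
      rwa [Equiv.symm_trans_apply, Equiv.symm_trans_apply, Equiv.symm_apply_apply,
        Equiv.symm_apply_apply] at this,
    fun h c c' hc => by
      rw [Equiv.symm_trans_apply, Equiv.symm_trans_apply]
      exact h _ _ ⟨hc.2, hc.1⟩⟩

theorem IsStandardListing.row_le_iff {n : ℕ} {μ : YoungDiagram} {e : Fin n ≃ μ.cells}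
    (he : IsStandardListing μ e) {j k : Fin n} (hjk : (j : ℕ) + 1 = k) :
    (e k).1.1 ≤ (e j).1.1 ↔ ¬ (e k).1.2 ≤ (e j).1.2 := by
  constructor
  · intro h1 h2
    have := he (e k) (e j) ⟨h1, h2⟩
    rw [e.symm_apply_apply, e.symm_apply_apply, Fin.le_def] at this
    omega
  · intro h2
    by_contra h1
    rw [not_le] at h1 h2
    let z : μ.cells := ⟨((e j).1.1, (e k).1.2), μ.up_left_mem h1.le le_rfl (e k).2⟩
    have hz1 := he (e j) z ⟨le_rfl, h2.le⟩
    have hz2 := he z (e k) ⟨h1.le, le_rfl⟩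
    rw [e.symm_apply_apply, Fin.le_def] at hz1 hz2
    have : e.symm z = j ∨ e.symm z = k := by
      by_contra! hne
      have := Fin.val_ne_of_ne hne.1
      have := Fin.val_ne_of_ne hne.2
      omega
    rcases this with h | h
    · have := congrArg (fun c : μ.cells => c.1.2) ((Equiv.symm_apply_eq e).mp h)
      exact h2.ne' this
    · have := congrArg (fun c : μ.cells => c.1.1) ((Equiv.symm_apply_eq e).mp h)
      exact h1.ne this

theorem descentSet_transpose {n : ℕ} {μ : YoungDiagram} {e : Fin n ≃ μ.cells}
    (he : IsStandardListing μ e) :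
    descentSet (fun j k => (transposeCells μ (e k)).1.2 ≤ (transposeCells μ (e j)).1.2) =
      Icc 1 (n - 1) \ descentSet fun j k => (e k).1.2 ≤ (e j).1.2 := by
  rw [sdiff_descentSet]
  exact descentSet_congr fun j k hjk => he.row_le_iff hjk

/-- Transposing a diagram complements the descent sets of its standard tableaux. -/
theorem schurCoeff_transpose {n : ℕ} {μ : YoungDiagram} (hμ : μ.cells.card = n) (m : ℕ →₀ ℕ) :
    schurCoeff μ.transpose m = ∑ e : Fin n ≃ μ.cells with IsStandardListing μ e,
      fqsymCoeff n ↑(Icc 1 (n - 1) \ descentSet fun j k => (e k).1.2 ≤ (e j).1.2) m := by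
  have hμ' : μ.transpose.cells.card = n := by
    rw [← hμ, ← Fintype.card_coe, ← Fintype.card_coe μ.cells]
    exact Fintype.card_congr (transposeCells μ).symm
  rw [schurCoeff_eq_sum_fqsymCoeff hμ']
  symm
  refine Finset.sum_equiv (Equiv.equivCongr (Equiv.refl _) (transposeCells μ)) ?_ ?_
  · intro e
    simp only [mem_filter, mem_univ, true_and]
    exact isStandardListing_transpose.symm
  · intro e he
    rw [← descentSet_transpose (mem_filter.mp he).2]
    rfl

/-- The vector of row lengths of a Young diagram. -/
noncomputable def rowContent (μ : YoungDiagram) : ℕ →₀ ℕ := content fun c : μ.cells => c.1.1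

/-- The sum of the row indices of the cells of a Young diagram. -/
def rowSum (μ : YoungDiagram) : ℕ := ∑ c : μ.cells, c.1.1

theorem rowContent_apply (μ : YoungDiagram) (i : ℕ) : rowContent μ i = μ.rowLen i := by
  rw [rowContent, content_apply, YoungDiagram.rowLen_eq_card, YoungDiagram.row]
  refine Finset.card_bij (fun c _ => c.1) ?_ ?_ ?_
  · intro c hc
    exact mem_filter.mpr ⟨c.2, (mem_filter.mp hc).2⟩
  · intro c _ c' _ h
    exact Subtype.ext h
  · intro c hc
    have := mem_filter.mp hc
    exact ⟨⟨c, this.1⟩, by simpa using this.2, rfl⟩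

theorem rowContent_injective : Function.Injective rowContent := by
  intro μ ν h
  refine YoungDiagram.ext (Finset.ext fun c => ?_)
  obtain ⟨i, j⟩ := c
  rw [YoungDiagram.mem_cells, YoungDiagram.mem_cells, YoungDiagram.mem_iff_lt_rowLen,
    YoungDiagram.mem_iff_lt_rowLen, ← rowContent_apply, h, rowContent_apply]

theorem rowContent_transpose (μ : YoungDiagram) :
    rowContent μ.transpose = content fun c : μ.cells => c.1.2 :=
  (content_comp_equiv (transposeCells μ) fun c : μ.transpose.cells => c.1.1).symm

theorem IsSemistandard.row_le {μ : YoungDiagram} {T : μ.cells → ℕ} (hT : IsSemistandard μ T)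
    (c : μ.cells) : c.1.1 ≤ T c := by
  obtain ⟨⟨i, j⟩, h⟩ := c
  induction i with
  | zero => exact Nat.zero_le _
  | succ i ih =>
    have h' : (i, j) ∈ μ.cells := μ.up_left_mem (Nat.le_succ i) le_rfl h
    exact (ih h').trans_lt (hT.2 ⟨(i, j), h'⟩ ⟨(i + 1, j), h⟩ rfl (Nat.lt_succ_self i))

theorem IsSemistandard.rowSum_le {μ ν : YoungDiagram} {T : μ.cells → ℕ} (hT : IsSemistandard μ T)
    (h : content T = rowContent ν) : rowSum μ ≤ rowSum ν := by
  have : ∑ c, T c = rowSum ν := sum_comp_of_content_eq h id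
  rw [← this]
  exact Finset.sum_le_sum fun c _ => hT.row_le c

theorem IsSemistandard.eq_row {μ ν : YoungDiagram} {T : μ.cells → ℕ} (hT : IsSemistandard μ T)
    (h : content T = rowContent ν) (h' : rowSum μ = rowSum ν) : T = fun c => c.1.1 := by
  have h1 : ∑ c, T c = rowSum ν := sum_comp_of_content_eq h id
  rw [← h', rowSum] at h1
  funext c
  exact ((Finset.sum_eq_sum_iff_of_le fun c _ => hT.row_le c).mp h1.symm c (mem_univ c)).symm

theorem schurCoeff_rowContent_self (μ : YoungDiagram) : schurCoeff μ (rowContent μ) = 1 := by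
  rw [schurCoeff_eq_ncard, Set.ncard_eq_one]
  refine ⟨fun c => c.1.1, Set.eq_singleton_iff_unique_mem.mpr ⟨⟨⟨?_, ?_⟩, rfl⟩, ?_⟩⟩
  · exact fun c c' h _ => h.le
  · exact fun c c' _ h => h
  · exact fun T hT => hT.1.eq_row hT.2 rfl

theorem exists_isSemistandard_of_schurCoeff_ne_zero {μ : YoungDiagram} {m : ℕ →₀ ℕ}
    (h : schurCoeff μ m ≠ 0) : ∃ T, IsSemistandard μ T ∧ content T = m := by
  rw [schurCoeff_eq_ncard] at h
  exact Set.nonempty_of_ncard_ne_zero h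

theorem rowSum_lt_of_schurCoeff_ne_zero {μ ν : YoungDiagram} (hne : μ ≠ ν)
    (h : schurCoeff μ (rowContent ν) ≠ 0) : rowSum μ < rowSum ν := by
  obtain ⟨T, hT, hm⟩ := exists_isSemistandard_of_schurCoeff_ne_zero h
  refine lt_of_le_of_ne (hT.rowSum_le hm) fun heq => hne (rowContent_injective ?_)
  rw [← hm, hT.eq_row hm heq, rowContent]

theorem sum_range_card_le_sum (s : Finset ℕ) :
    ∑ i ∈ range s.card, i ≤ ∑ i ∈ s, i ∧
      (∑ i ∈ range s.card, i = ∑ i ∈ s, i → s = range s.card) := by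
  let o := s.orderEmbOfFin rfl
  have hs : ∑ i ∈ s, i = ∑ k : Fin s.card, o k := by
    have hmap : univ.map o.toEmbedding = s := s.map_orderEmbOfFin_univ rfl
    conv_lhs => rw [← hmap]
    rw [Finset.sum_map]; rfl
  have hle : ∀ k ∈ (univ : Finset (Fin s.card)), (k : ℕ) ≤ o k := by
    rintro ⟨k, hk⟩ -
    induction k with
    | zero => exact Nat.zero_le _
    | succ k ih =>
      exact (ih (by omega)).trans_lt (o.strictMono (Fin.mk_lt_mk.mpr (Nat.lt_succ_self k)))
  rw [hs, Finset.sum_range fun i => i]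
  refine ⟨Finset.sum_le_sum hle, fun h => ?_⟩
  have heq := (Finset.sum_eq_sum_iff_of_le hle).mp h
  refine Finset.eq_of_subset_of_card_le (fun x hx => ?_) (by simp)
  have hmap : x ∈ univ.map o.toEmbedding := by rwa [s.map_orderEmbOfFin_univ rfl]
  obtain ⟨k, -, rfl⟩ := mem_map.mp hmap
  have := heq k (mem_univ k)
  rw [mem_range]
  exact this ▸ k.2

/-- A set of cells with the same column lengths as a Young diagram `κ` has a row sum at least that
of `κ`, with equality only for `κ` itself. -/
theorem rowSum_le_sum_of_content_eq {X : Type*} [Fintype X] {κ : YoungDiagram} {u f : X → ℕ}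
    (hinj : ∀ x y, f x = f y → u x = u y → x = y) (hf : content f = rowContent κ.transpose) :
    rowSum κ ≤ ∑ x, u x ∧ (rowSum κ = ∑ x, u x → ∀ x, (u x, f x) ∈ κ.cells) := by
  have hX : ∑ x, u x = ∑ v ∈ (content f).support, ∑ i ∈ (univ.filter fun x => f x = v).image u, i := by
    rw [← Finset.sum_fiberwise_of_maps_to (t := (content f).support) (g := f)
      (fun x _ => mem_support_content f x)]
    refine Finset.sum_congr rfl fun v _ => (Finset.sum_image (f := fun i => i) ?_).symm
    intro x hx y hy hxy
    have hx := (mem_filter.mp hx).2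
    have hy := (mem_filter.mp hy).2
    exact hinj x y (hx.trans hy.symm) hxy
  have hcard : ∀ v, ((univ.filter fun x => f x = v).image u).card = κ.colLen v := by
    intro v
    rw [Finset.card_image_of_injOn, ← content_apply, hf, rowContent_apply,
      YoungDiagram.rowLen_transpose]
    intro x hx y hy hxy
    have hx : f x = v := by simpa using hx
    have hy : f y = v := by simpa using hy
    exact hinj x y (hx.trans hy.symm) hxy
  have hκ : rowSum κ = ∑ v ∈ (content f).support, ∑ i ∈ range (κ.colLen v), i := by
    rw [hf, rowContent_transpose, rowSum,
      ← Finset.sum_fiberwise_of_maps_to (t := (content fun c : κ.cells => c.1.2).support)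
        (g := fun c : κ.cells => c.1.2) (fun c _ => mem_support_content _ c)]
    refine Finset.sum_congr rfl fun v _ => ?_
    refine Finset.sum_bij (fun c _ => c.1.1) ?_ ?_ ?_ (fun _ _ => rfl)
    · rintro ⟨⟨i, j⟩, hc⟩ h
      obtain rfl : j = v := (mem_filter.mp h).2
      exact mem_range.mpr (YoungDiagram.mem_iff_lt_colLen.mp hc)
    · intro c hc c' hc' h
      exact Subtype.ext (Prod.ext h ((mem_filter.mp hc).2.trans (mem_filter.mp hc').2.symm))
    · intro i hi
      exact ⟨⟨(i, v), YoungDiagram.mem_iff_lt_colLen.mpr (mem_range.mp hi)⟩, by simp, rfl⟩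
  have hle : ∀ v ∈ (content f).support, ∑ i ∈ range (κ.colLen v), i ≤
      ∑ i ∈ (univ.filter fun x => f x = v).image u, i := fun v _ => by
    rw [← hcard v]; exact (sum_range_card_le_sum _).1
  rw [hX, hκ]
  refine ⟨Finset.sum_le_sum hle, fun h x => ?_⟩
  have hv := (Finset.sum_eq_sum_iff_of_le hle).mp h (f x) (mem_support_content f x)
  rw [← hcard (f x)] at hv
  have hr := (sum_range_card_le_sum _).2 hv
  rw [hcard] at hr
  have : u x ∈ (univ.filter fun y => f y = f x).image u :=
    mem_image_of_mem _ (by simp)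
  rw [hr, mem_range] at this
  exact YoungDiagram.mem_iff_lt_colLen.mpr this

theorem surjective_of_mem_cells {X : Type*} [Fintype X] {κ : YoungDiagram} {u f : X → ℕ}
    (hX : Fintype.card X = κ.cells.card)
    (hinj : ∀ x y, f x = f y → u x = u y → x = y) (hmem : ∀ x, (u x, f x) ∈ κ.cells) :
    Function.Bijective fun x => (⟨(u x, f x), hmem x⟩ : κ.cells) := by
  refine (Fintype.bijective_iff_injective_and_card _).mpr ⟨fun x y h => ?_, by simpa using hX⟩
  have := Prod.ext_iff.mp (Subtype.ext_iff.mp h)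
  exact hinj x y this.2 this.1

theorem eq_of_content_eq {X : Type*} [Fintype X] {κ ν : YoungDiagram} {u f : X → ℕ}
    (hX : Fintype.card X = κ.cells.card)
    (hinj : ∀ x y, f x = f y → u x = u y → x = y) (hmem : ∀ x, (u x, f x) ∈ κ.cells)
    (hu : content u = rowContent ν) : κ = ν := by
  refine rowContent_injective (hu ▸ ?_)
  exact (content_comp_equiv (Equiv.ofBijective _ (surjective_of_mem_cells hX hinj hmem))
    fun c : κ.cells => c.1.1).symm

theorem rowSum_lt_of_content_eq {X : Type*} [Fintype X] {κ ν : YoungDiagram} {u f : X → ℕ}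
    (hX : Fintype.card X = κ.cells.card) (hne : κ ≠ ν)
    (hinj : ∀ x y, f x = f y → u x = u y → x = y) (hf : content f = rowContent κ.transpose)
    (hu : content u = rowContent ν) : rowSum κ < rowSum ν := by
  have h1 := rowSum_le_sum_of_content_eq hinj hf
  have h2 : ∑ x, u x = rowSum ν := sum_comp_of_content_eq hu id
  rw [h2] at h1
  exact lt_of_le_of_ne h1.1 fun h => hne (eq_of_content_eq hX hinj (h1.2 h) hu)

theorem rowSum_lt_of_schurCoeff_transpose_ne_zero {κ ν : YoungDiagram}
    (hcard : ν.cells.card = κ.cells.card) (hne : κ ≠ ν)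
    (h : schurCoeff ν.transpose (rowContent κ.transpose) ≠ 0) : rowSum κ < rowSum ν := by
  obtain ⟨T, hT, hm⟩ := exists_isSemistandard_of_schurCoeff_ne_zero h
  refine rowSum_lt_of_content_eq (X := ν.transpose.cells) (u := fun c => c.1.2) (f := T) ?_ hne
    hT.key_injective hm ?_
  · rw [← hcard, ← Fintype.card_coe ν.cells]
    exact Fintype.card_congr (transposeCells ν).symm
  · rw [← rowContent_transpose, YoungDiagram.transpose_transpose]

/-- The descent set of a word. -/
noncomputable def wordDescent {n : ℕ} (u : Fin n → ℕ) : Finset ℕ :=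
  descentSet fun j k => u k < u j

/-- The descent set of a permutation. -/
noncomputable def permDescent {n : ℕ} (σ : Equiv.Perm (Fin n)) : Finset ℕ :=
  descentSet fun j k => σ k ≤ σ j

/-- The finite set of fillings of content `m`. -/
noncomputable def withContent (X : Type*) [Fintype X] (m : ℕ →₀ ℕ) : Finset (X → ℕ) :=
  (finite_content_eq m).toFinset

theorem mem_withContent {X : Type*} [Fintype X] {m : ℕ →₀ ℕ} {f : X → ℕ} :
    f ∈ withContent X m ↔ content f = m := by
  rw [withContent, Set.Finite.mem_toFinset, Set.mem_ofPred_eq]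

theorem wordDescent_eq_permDescent {n : ℕ} {u : Fin n → ℕ} {σ : Equiv.Perm (Fin n)}
    (h : IsStandardization id u σ) : wordDescent u = permDescent σ.symm := by
  refine descentSet_congr fun j k hjk => ?_
  have hlt : σ.symm k < σ.symm j ↔ u k < u j ∨ u k = u j ∧ k < j := by
    have := h.lt_iff_lt (a := σ.symm k) (b := σ.symm j)
    simpa [Prod.Lex.toLex_lt_toLex] using this.symm
  have hjk' := lt_of_succ hjk
  rw [(σ.symm.injective.ne hjk'.ne').le_iff_lt, hlt]
  constructor
  · exact Or.inl
  · rintro (h1 | h1)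
    exacts [h1, absurd h1.2 hjk'.not_gt]

/-- The sum over words of a function of the descent set, expanded into fundamental quasisymmetric
functions. -/
theorem sum_wordDescent_eq {n : ℕ} (v : Finset ℕ → ℚ) (m : ℕ →₀ ℕ) :
    ∑ u ∈ withContent (Fin n) m, v (wordDescent u) =
      ∑ σ : Equiv.Perm (Fin n), v (permDescent σ.symm) * fqsymCoeff n ↑(permDescent σ) m := by
  have hS : ∀ S, ((withContent (Fin n) m).filter fun u => wordDescent u = S).card =
      ∑ σ : Equiv.Perm (Fin n) with permDescent σ.symm = S, fqsymCoeff n ↑(permDescent σ) m := by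
    intro S
    have := ncard_eq_sum_fqsymCoeff (id : Fin n → Fin n) (by simp) (fun u => wordDescent u = S)
      (fun σ => permDescent σ.symm = S) (fun _ _ _ _ _ h => h)
      (fun u σ h => by rw [wordDescent_eq_permDescent h]) m
    rw [← Set.ncard_coe_finset]
    convert this using 2
    · ext u
      rw [mem_coe, mem_filter, mem_withContent, Set.mem_ofPred_eq, and_comm]
    · ext; simp
    · rfl
  rw [← Finset.sum_fiberwise_of_maps_to (t := (Icc 1 (n - 1)).powerset) (g := wordDescent)
      (fun u _ => mem_powerset.mpr (descentSet_subset _)),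
    ← Finset.sum_fiberwise_of_maps_to (t := (Icc 1 (n - 1)).powerset)
      (g := fun σ : Equiv.Perm (Fin n) => permDescent σ.symm)
      (fun u _ => mem_powerset.mpr (descentSet_subset _))]
  refine Finset.sum_congr rfl fun S _ => ?_
  have h1 : ∀ u ∈ (withContent (Fin n) m).filter (fun u => wordDescent u = S),
      v (wordDescent u) = v S := fun u hu => by rw [(mem_filter.mp hu).2]
  rw [Finset.sum_congr rfl h1, Finset.sum_const, hS, nsmul_eq_mul, Nat.cast_sum, Finset.sum_mul]
  refine Finset.sum_congr rfl fun σ hσ => ?_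
  rw [(mem_filter.mp hσ).2, mul_comm]

/-- The symmetric bilinear form on functions of descent sets counting permutations by the descent
sets of the inverse and of the permutation. -/
noncomputable def descentForm (n : ℕ) (v v' : Finset ℕ → ℚ) : ℚ :=
  ∑ σ : Equiv.Perm (Fin n), v (permDescent σ.symm) * v' (permDescent σ)

theorem descentForm_comm (n : ℕ) (v v' : Finset ℕ → ℚ) :
    descentForm n v v' = descentForm n v' v := by
  refine Fintype.sum_equiv (Equiv.inv (Equiv.Perm (Fin n))) _ _ fun σ => ?_
  exact mul_comm _ _

theorem strictMono_toLex_toDual_iff {n : ℕ} (f u : Fin n → ℕ) :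
    StrictMono (fun k => toLex (f k, OrderDual.toDual (u k))) ↔ Monotone f ∧
      ∀ j k : Fin n, (j : ℕ) + 1 = k →
        (j : ℕ) + 1 ∈ (↑(Icc 1 (n - 1) \ wordDescent u) : Set ℕ) → f j < f k := by
  rw [strictMono_toLex_iff, wordDescent, sdiff_descentSet]
  simp only [not_lt, OrderDual.toDual_le_toDual]

theorem fqsymCoeff_sdiff_wordDescent {n : ℕ} (u : Fin n → ℕ) (m : ℕ →₀ ℕ) :
    fqsymCoeff n ↑(Icc 1 (n - 1) \ wordDescent u) m = Set.ncard {f : Fin n → ℕ |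
      StrictMono (fun k => toLex (f k, OrderDual.toDual (u k))) ∧ content f = m} := by
  rw [fqsymCoeff_eq_ncard]
  simp only [strictMono_toLex_toDual_iff, and_assoc]

theorem eq_and_eq_of_strictMono_toLex {n : ℕ} {f u : Fin n → ℕ}
    (h : StrictMono (fun k => toLex (f k, OrderDual.toDual (u k)))) (x y : Fin n)
    (h1 : f x = f y) (h2 : u x = u y) : x = y :=
  h.injective (by simp only [h1, h2])

theorem rowSum_lt_of_sum_wordDescent_ne_zero {n : ℕ} {κ ν : YoungDiagram}
    (hκ : κ.cells.card = n) (hne : κ ≠ ν)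
    (h : ∑ u ∈ withContent (Fin n) (rowContent ν),
      (fqsymCoeff n ↑(Icc 1 (n - 1) \ wordDescent u) (rowContent κ.transpose) : ℚ) ≠ 0) :
    rowSum κ < rowSum ν := by
  obtain ⟨u, hu, hne'⟩ := Finset.exists_ne_zero_of_sum_ne_zero h
  rw [Nat.cast_ne_zero, fqsymCoeff_sdiff_wordDescent] at hne'
  obtain ⟨f, hf, hm⟩ := Set.nonempty_of_ncard_ne_zero hne'
  exact rowSum_lt_of_content_eq (by simpa using hκ.symm) hne (eq_and_eq_of_strictMono_toLex hf) hm
    (mem_withContent.mp hu)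

theorem sum_wordDescent_self {n : ℕ} {κ : YoungDiagram} (hκ : κ.cells.card = n) :
    ∑ u ∈ withContent (Fin n) (rowContent κ),
      (fqsymCoeff n ↑(Icc 1 (n - 1) \ wordDescent u) (rowContent κ.transpose) : ℚ) = 1 := by
  obtain ⟨e, he⟩ := exists_isStandardization (n := n) (col := fun c : κ.cells =>
    OrderDual.toDual c.1.1) (T := fun c => c.1.2) (by simpa using hκ)
    (fun x y h1 h2 => Subtype.ext (Prod.ext h2 h1))
  have huniq : ∀ u f : Fin n → ℕ, content u = rowContent κ → content f = rowContent κ.transpose →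
      StrictMono (fun k => toLex (f k, OrderDual.toDual (u k))) →
      u = (fun k => (e k).1.1) ∧ f = fun k => (e k).1.2 := by
    intro u f hu hf hs
    have hinj := eq_and_eq_of_strictMono_toLex hs
    have hmem := (rowSum_le_sum_of_content_eq hinj hf).2
      (sum_comp_of_content_eq hu id).symm
    let e' : Fin n ≃ κ.cells :=
      Equiv.ofBijective _ (surjective_of_mem_cells (by simpa using hκ.symm) hinj hmem)
    have he' : IsStandardization (fun c : κ.cells => OrderDual.toDual c.1.1) (fun c => c.1.2) e' :=
      hs
    rw [← he'.unique he]
    exact ⟨rfl, rfl⟩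
  rw [Finset.sum_eq_single fun k => (e k).1.1]
  · rw [fqsymCoeff_sdiff_wordDescent, Nat.cast_eq_one, Set.ncard_eq_one]
    refine ⟨fun k => (e k).1.2, Set.eq_singleton_iff_unique_mem.mpr ⟨⟨he, ?_⟩, ?_⟩⟩
    · rw [rowContent_transpose]
      exact content_comp_equiv e fun c : κ.cells => c.1.2
    · rintro f ⟨hs, hf⟩
      exact (huniq _ f (content_comp_equiv e fun c : κ.cells => c.1.1) hf hs).2
  · intro u hu hne
    rw [fqsymCoeff_sdiff_wordDescent, Nat.cast_eq_zero, Set.ncard_eq_zero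
      ((finite_content_eq (rowContent κ.transpose)).subset fun f h => h.2)]
    refine Set.eq_empty_iff_forall_notMem.mpr ?_
    rintro f ⟨hs, hf⟩
    exact hne (huniq u f (mem_withContent.mp hu) hf hs).1
  · intro h
    exact absurd (mem_withContent.mpr (content_comp_equiv e fun c : κ.cells => c.1.1)) h

/-- The part of `S` beyond `a`, translated so as to start at `1`. -/
noncomputable def shiftSet (a : ℕ) (S : Finset ℕ) : Finset ℕ :=
  (S.filter (a < ·)).image (· - a)

theorem mem_shiftSet {a : ℕ} {S : Finset ℕ} {j : ℕ} : j ∈ shiftSet a S ↔ 0 < j ∧ a + j ∈ S := by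
  simp only [shiftSet, mem_image, mem_filter]
  constructor
  · rintro ⟨x, ⟨hx, hax⟩, rfl⟩
    exact ⟨by omega, by rwa [Nat.add_sub_cancel' hax.le]⟩
  · rintro ⟨h1, h2⟩
    exact ⟨a + j, ⟨h2, by omega⟩, by omega⟩

/-- The signed indicator of the `α`-unimodality of `S`. -/
noncomputable def unimodalSign (α : List ℕ) (S : Finset ℕ) : ℤ :=
  if AlphaUnimodal α ↑S then (-1) ^ ((↑S : Set ℕ) \ partialSums α).ncard else 0

/-- The signed indicator of `S` meeting the open interval from `0` to `r` in an initial part. -/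
noncomputable def blockSign (r : ℕ) (S : Finset ℕ) : ℤ :=
  if ∀ j k, 0 < j → j < k → k < r → k ∈ S → j ∈ S then (-1) ^ (S.filter (· ∈ Ioo 0 r)).card else 0

theorem alphaUnimodal_cons {a : ℕ} {α : List ℕ} {S : Finset ℕ} :
    AlphaUnimodal (a :: α) ↑S ↔ (∀ j k, 0 < j → j < k → k < a → k ∈ S → j ∈ S) ∧
      AlphaUnimodal α ↑(shiftSet a S) := by
  constructor
  · intro h
    refine ⟨fun j k h0 hjk hka hk => h j k hjk hk ⟨0, by simp, by simpa, by simpa⟩, ?_⟩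
    rintro j k hjk hk ⟨i, hi, h1, h2⟩
    rw [mem_coe, mem_shiftSet] at hk ⊢
    exact ⟨by omega, h (a + j) (a + k) (by omega) hk.2
      ⟨i + 1, by simpa, by simpa, by simpa⟩⟩
  · rintro ⟨h1, h2⟩ j k hjk hk ⟨i, hi, hij, hik⟩
    cases i with
    | zero => exact h1 j k (by simpa using hij) hjk (by simpa using hik) hk
    | succ i =>
      simp only [List.take_succ_cons, List.sum_cons, List.length_cons] at hi hij hik
      have := h2 (j - a) (k - a) (by omega)
        (mem_shiftSet.mpr ⟨by omega, by rwa [Nat.add_sub_cancel' (by omega)]⟩)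
        ⟨i, by omega, by omega, by omega⟩
      have := (mem_shiftSet.mp this).2
      rwa [Nat.add_sub_cancel' (by omega)] at this

theorem mem_partialSums_cons {a : ℕ} {α : List ℕ} {x : ℕ} :
    x ∈ partialSums (a :: α) ↔ x = a ∨ ∃ y ∈ partialSums α, x = a + y := by
  constructor
  · rintro ⟨i, hi, rfl⟩
    cases i with
    | zero => simp
    | succ i => exact Or.inr ⟨_, ⟨i, by simpa using hi, rfl⟩, by simp⟩
  · rintro (rfl | ⟨y, ⟨i, hi, rfl⟩, rfl⟩)
    · exact ⟨0, by simp, by simp⟩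
    · exact ⟨i + 1, by simpa, by simp⟩

theorem unimodalSign_cons {a : ℕ} {α : List ℕ} {S : Finset ℕ} (hS : ∀ x ∈ S, 0 < x) :
    unimodalSign (a :: α) S = blockSign a S * unimodalSign α (shiftSet a S) := by
  have hcard : ((↑S : Set ℕ) \ partialSums (a :: α)).ncard = (S.filter (· ∈ Ioo 0 a)).card +
      ((↑(shiftSet a S) : Set ℕ) \ partialSums α).ncard := by
    have hU : (↑S : Set ℕ) \ partialSums (a :: α) = ↑(S.filter (· ∈ Ioo 0 a)) ∪
        (fun x => a + x) '' ((↑(shiftSet a S) : Set ℕ) \ partialSums α) := by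
      ext x
      simp only [Set.mem_sdiff, mem_coe, mem_partialSums_cons, Set.mem_union, mem_filter, mem_Ioo,
        Set.mem_image, mem_shiftSet]
      constructor
      · rintro ⟨hx, hn⟩
        push Not at hn
        rcases lt_or_ge x a with h | h
        · exact Or.inl ⟨hx, hS x hx, h⟩
        · exact Or.inr ⟨x - a, ⟨⟨by omega, by rwa [Nat.add_sub_cancel' h]⟩,
            fun hx' => hn.2 _ hx' (by omega)⟩, by omega⟩
      · rintro (⟨hx, h0, hxa⟩ | ⟨y, ⟨⟨hy0, hy⟩, hn⟩, rfl⟩)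
        · exact ⟨hx, by push Not; exact ⟨by omega, fun y _ => by omega⟩⟩
        · refine ⟨hy, ?_⟩
          rintro (h | ⟨z, hz, h⟩)
          · omega
          · obtain rfl : y = z := by omega
            exact hn hz
    rw [hU, Set.ncard_union_eq, Set.ncard_coe_finset,
      Set.ncard_image_of_injective _ (add_right_injective a)]
    rw [Set.disjoint_left]
    rintro x hx ⟨y, -, rfl⟩
    have := (mem_filter.mp (mem_coe.mp hx)).2
    rw [mem_Ioo] at this
    exact absurd this.2 (by simp)
  rw [unimodalSign, unimodalSign, blockSign, hcard, pow_add]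
  by_cases h1 : ∀ j k, 0 < j → j < k → k < a → k ∈ S → j ∈ S
  · by_cases h2 : AlphaUnimodal α ↑(shiftSet a S)
    · rw [if_pos (alphaUnimodal_cons.mpr ⟨h1, h2⟩), if_pos h1, if_pos h2]
    · rw [if_neg (fun h => h2 (alphaUnimodal_cons.mp h).2), if_neg h2, mul_zero]
  · rw [if_neg (fun h => h1 (alphaUnimodal_cons.mp h).1), if_neg h1, zero_mul]

theorem blockSign_congr {r : ℕ} {S S' : Finset ℕ} (h : ∀ x, 0 < x → x < r → (x ∈ S ↔ x ∈ S')) :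
    blockSign r S = blockSign r S' := by
  have h1 : (∀ j k, 0 < j → j < k → k < r → k ∈ S → j ∈ S) ↔
      ∀ j k, 0 < j → j < k → k < r → k ∈ S' → j ∈ S' :=
    forall_congr' fun j => forall_congr' fun k => forall_congr' fun h0 => forall_congr' fun hjk =>
      forall_congr' fun hk => by rw [h j h0 (hjk.trans hk), h k (h0.trans hjk) hk]
  have h2 : S.filter (· ∈ Ioo 0 r) = S'.filter (· ∈ Ioo 0 r) := by
    ext x
    simp only [mem_filter, mem_Ioo]
    exact and_congr_left fun hx => h x hx.1 hx.2
  simp only [blockSign, h1, h2]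

theorem blockSign_succ_of_one_mem {r : ℕ} {S : Finset ℕ} (hr : 0 < r) (h : 1 ∈ S) :
    blockSign (r + 1) S = -blockSign r (shiftSet 1 S) := by
  have h1 : (∀ j k, 0 < j → j < k → k < r + 1 → k ∈ S → j ∈ S) ↔
      ∀ j k, 0 < j → j < k → k < r → k ∈ shiftSet 1 S → j ∈ shiftSet 1 S := by
    simp only [mem_shiftSet]
    constructor
    · intro H j k h0 hjk hk hkS
      exact ⟨h0, H (1 + j) (1 + k) (by omega) (by omega) (by omega) hkS.2⟩
    · intro H j k h0 hjk hk hkS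
      obtain rfl | hj := Nat.eq_or_lt_of_le (Nat.succ_le_of_lt h0)
      · exact h
      · have := (H (j - 1) (k - 1) (by omega) (by omega) (by omega)
          ⟨by omega, by rwa [Nat.add_sub_cancel' (by omega)]⟩).2
        rwa [Nat.add_sub_cancel' (by omega)] at this
  have h2 : S.filter (· ∈ Ioo 0 (r + 1)) =
      insert 1 (((shiftSet 1 S).filter (· ∈ Ioo 0 r)).image (1 + ·)) := by
    ext x
    simp only [mem_filter, mem_Ioo, mem_insert, mem_image, mem_shiftSet]
    constructor
    · rintro ⟨hx, h0, hxr⟩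
      obtain rfl | hj := Nat.eq_or_lt_of_le (Nat.succ_le_of_lt h0)
      · exact Or.inl rfl
      · exact Or.inr ⟨x - 1, ⟨⟨by omega, by rwa [Nat.add_sub_cancel' (by omega)]⟩, by omega,
          by omega⟩, by omega⟩
    · rintro (rfl | ⟨y, ⟨⟨hy0, hy⟩, -, hyr⟩, rfl⟩)
      · exact ⟨h, by omega, by omega⟩
      · exact ⟨hy, by omega, by omega⟩
  have h3 : 1 ∉ ((shiftSet 1 S).filter (· ∈ Ioo 0 r)).image (1 + ·) := by
    simp only [mem_image, mem_filter, mem_Ioo, not_exists]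
    rintro x ⟨⟨-, h0, -⟩, hx⟩
    omega
  simp only [blockSign, h1, h2, card_insert_of_notMem h3,
    card_image_of_injective _ (add_right_injective 1), pow_succ, mul_neg, mul_one]
  split_ifs <;> simp

theorem mem_wordDescent {n : ℕ} {u : Fin n → ℕ} {x : ℕ} :
    x ∈ wordDescent u ↔ ∃ (h0 : 0 < x) (h : x < n), u ⟨x, h⟩ < u ⟨x - 1, by omega⟩ := by
  rw [wordDescent, mem_descentSet]
  constructor
  · rintro ⟨j, k, hjk, hR, rfl⟩
    have hj : j = ⟨k - 1, by omega⟩ := Fin.ext (by simp; omega)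
    exact ⟨by omega, k.2, hj ▸ hR⟩
  · rintro ⟨h0, h, hR⟩
    exact ⟨_, _, by simp; omega, hR, rfl⟩

theorem pos_of_mem_wordDescent {n : ℕ} {u : Fin n → ℕ} {x : ℕ} (h : x ∈ wordDescent u) : 0 < x :=
  (mem_wordDescent.mp h).1

theorem shiftSet_wordDescent_append {r s : ℕ} (v : Fin r → ℕ) (u : Fin s → ℕ) :
    shiftSet r (wordDescent (Fin.append v u)) = wordDescent u := by
  ext x
  rw [mem_shiftSet, mem_wordDescent, mem_wordDescent]
  constructor
  · rintro ⟨h0, h1, h2, h3⟩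
    refine ⟨h0, by omega, ?_⟩
    have e1 : (⟨r + x, h2⟩ : Fin (r + s)) = Fin.natAdd r ⟨x, by omega⟩ := rfl
    have e2 : (⟨r + x - 1, by omega⟩ : Fin (r + s)) = Fin.natAdd r ⟨x - 1, by omega⟩ :=
      Fin.ext (by simp; omega)
    rwa [e1, e2, Fin.append_right, Fin.append_right] at h3
  · rintro ⟨h0, h2, h3⟩
    refine ⟨h0, by omega, by omega, ?_⟩
    have e1 : (⟨r + x, by omega⟩ : Fin (r + s)) = Fin.natAdd r ⟨x, by omega⟩ := rfl
    have e2 : (⟨r + x - 1, by omega⟩ : Fin (r + s)) = Fin.natAdd r ⟨x - 1, by omega⟩ :=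
      Fin.ext (by simp; omega)
    rwa [e1, e2, Fin.append_right, Fin.append_right]

theorem mem_wordDescent_append {r s : ℕ} (v : Fin r → ℕ) (u : Fin s → ℕ) {x : ℕ} (hx : x < r) :
    x ∈ wordDescent (Fin.append v u) ↔ x ∈ wordDescent v := by
  rw [mem_wordDescent, mem_wordDescent]
  have e1 : (⟨x, by omega⟩ : Fin (r + s)) = Fin.castAdd s ⟨x, hx⟩ := rfl
  have e2 : (⟨x - 1, by omega⟩ : Fin (r + s)) = Fin.castAdd s ⟨x - 1, by omega⟩ := rfl
  simp only [e1, e2, Fin.append_left, hx, exists_true_left, show x < r + s by omega]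

theorem unimodalSign_append {r s : ℕ} {α : List ℕ} (v : Fin r → ℕ) (u : Fin s → ℕ) :
    unimodalSign (r :: α) (wordDescent (Fin.append v u)) =
      blockSign r (wordDescent v) * unimodalSign α (wordDescent u) := by
  rw [unimodalSign_cons fun x hx => pos_of_mem_wordDescent hx, shiftSet_wordDescent_append,
    blockSign_congr fun x _ hx => mem_wordDescent_append v u hx]

theorem mem_wordDescent_init {r : ℕ} (v : Fin (r + 1) → ℕ) {x : ℕ} (hx : x < r) :
    x ∈ wordDescent (Fin.init v) ↔ x ∈ wordDescent v := by
  rw [mem_wordDescent, mem_wordDescent]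
  simp only [Fin.init, Fin.castSucc_mk, hx, exists_true_left, show x < r + 1 by omega]

theorem shiftSet_wordDescent {r : ℕ} (v : Fin (r + 1) → ℕ) :
    shiftSet 1 (wordDescent v) = wordDescent (Fin.tail v) := by
  ext x
  rw [mem_shiftSet, mem_wordDescent, mem_wordDescent]
  have e1 : ∀ h, (⟨1 + x, h⟩ : Fin (r + 1)) = Fin.succ ⟨x, by omega⟩ := fun h =>
    Fin.ext (by simp; omega)
  have e2 : ∀ (h0 : 0 < x) h, (⟨1 + x - 1, h⟩ : Fin (r + 1)) = Fin.succ ⟨x - 1, by omega⟩ :=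
    fun h0 h => Fin.ext (by simp; omega)
  constructor
  · rintro ⟨h0, h1, h2, h3⟩
    rw [e1, e2 h0] at h3
    exact ⟨h0, by omega, h3⟩
  · rintro ⟨h0, h2, h3⟩
    refine ⟨h0, by omega, by omega, ?_⟩
    rw [e1, e2 h0]
    exact h3

/-- The telescoping term in the expansion of power sums. -/
noncomputable def blockTerm {r : ℕ} (t : Fin (r + 1) → ℕ) (a : ℕ) : ℤ :=
  if t 0 < a ∧ t (Fin.last r) ≤ a then blockSign (r + 1) (wordDescent t) else 0

theorem blockSign_wordDescent {r : ℕ} (v : Fin (r + 2) → ℕ) :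
    blockSign (r + 2) (wordDescent v) = (if v = fun _ => v 0 then 1 else 0) +
      blockTerm (Fin.init v) (v (Fin.last _)) - blockTerm (Fin.tail v) (v 0) := by
  have t0 : Fin.tail v 0 = v 1 := rfl
  have tl : Fin.tail v (Fin.last r) = v (Fin.last _) := rfl
  have i0 : Fin.init v 0 = v 0 := rfl
  have il : Fin.init v (Fin.last r) = v (Fin.last r).castSucc := rfl
  have hlast : r + 1 ∈ wordDescent v ↔ v (Fin.last _) < v (Fin.last r).castSucc := by
    rw [mem_wordDescent]
    exact ⟨fun h => h.2.2, fun h => ⟨by omega, by omega, h⟩⟩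
  have hone : 1 ∈ wordDescent v ↔ v 1 < v 0 := by
    rw [mem_wordDescent]
    exact ⟨fun h => h.2.2, fun h => ⟨by omega, by omega, h⟩⟩
  rw [blockTerm, blockTerm, t0, tl, i0, il]
  rcases lt_or_ge (v 0) (v (Fin.last _)) with h | h
  · rw [if_neg (fun hc => by have := congrFun hc (Fin.last _); omega),
      if_neg (fun hc : v 1 < v 0 ∧ _ => by omega), zero_add, sub_zero]
    by_cases hl : v (Fin.last r).castSucc ≤ v (Fin.last _)
    · rw [if_pos ⟨h, hl⟩, blockSign_congr fun x _ hx => mem_wordDescent_init v hx]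
      have hn : r + 1 ∉ wordDescent v := fun hc => absurd (hlast.mp hc) (not_lt.mpr hl)
      have h1 : (∀ j k, 0 < j → j < k → k < r + 2 → k ∈ wordDescent v → j ∈ wordDescent v) ↔
          ∀ j k, 0 < j → j < k → k < r + 1 → k ∈ wordDescent v → j ∈ wordDescent v := by
        refine ⟨fun H j k h0 hjk hk => H j k h0 hjk (by omega), fun H j k h0 hjk hk hkS => ?_⟩
        have hne : k ≠ r + 1 := by rintro rfl; exact hn hkS
        exact H j k h0 hjk (by omega) hkS
      have h2 : (wordDescent v).filter (· ∈ Ioo 0 (r + 2)) =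
          (wordDescent v).filter (· ∈ Ioo 0 (r + 1)) := by
        refine Finset.filter_congr fun x hx => ?_
        have hne : x ≠ r + 1 := by rintro rfl; exact hn hx
        rw [mem_Ioo, mem_Ioo]
        omega
      simp only [blockSign, h1, h2]
    · rw [if_neg (fun hc => hl hc.2), blockSign, if_neg]
      intro H
      have hanti : ∀ x (hx : x < r + 2), v ⟨x, hx⟩ ≤ v 0 := by
        intro x
        induction x with
        | zero => exact fun _ => le_rfl
        | succ x ih =>
          intro hx
          have hmem : x + 1 ∈ wordDescent v := by
            rcases Nat.lt_or_ge x r with hxr | hxr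
            · exact H (x + 1) (r + 1) (by omega) (by omega) (by omega)
                (hlast.mpr (not_le.mp hl))
            · obtain rfl : x = r := by omega
              exact hlast.mpr (not_le.mp hl)
          obtain ⟨_, _, hlt⟩ := mem_wordDescent.mp hmem
          exact hlt.le.trans (ih (by omega))
      exact absurd (hanti (r + 1) (by omega)) (not_le.mpr h)
  · rw [if_neg (fun hc : v 0 < v (Fin.last _) ∧ _ => by omega), add_zero]
    by_cases h10 : v 1 < v 0
    · have hc : v ≠ fun _ => v 0 := fun hc => by have := congrFun hc 1; omega
      rw [if_neg hc, if_pos ⟨h10, h⟩, zero_sub,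
        blockSign_succ_of_one_mem (by omega) (hone.mpr h10), shiftSet_wordDescent]
    · rw [if_neg (fun hc : v 1 < v 0 ∧ _ => h10 hc.1), sub_zero]
      by_cases hempty : wordDescent v = ∅
      · have hmono : Monotone v := monotone_of_le_of_succ fun j k hjk => by
          by_contra hc
          have : (j : ℕ) + 1 ∈ wordDescent v := (succ_mem_descentSet hjk).mpr (not_le.mp hc)
          simp [hempty] at this
        rw [if_pos (funext fun x =>
          le_antisymm ((hmono (Fin.le_last x)).trans h) (hmono (Fin.zero_le x))), hempty]
        simp [blockSign]
      · obtain ⟨x, hx⟩ := Finset.nonempty_iff_ne_empty.mpr hempty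
        obtain ⟨hx0, hxr, hlt⟩ := mem_wordDescent.mp hx
        rw [if_neg, blockSign, if_neg]
        · intro H
          obtain rfl | hx1 := Nat.eq_or_lt_of_le (Nat.succ_le_of_lt hx0)
          · exact h10 (hone.mp hx)
          · exact h10 (hone.mp (H 1 x one_pos hx1 hxr hx))
        · intro hc
          rw [hc] at hlt
          exact lt_irrefl _ hlt

open MvPolynomial in
/-- The generating function of one block is a power sum. -/
theorem sum_blockSign_mul_prod (A : Finset ℕ) (r : ℕ) :
    ∑ v : Fin (r + 1) → A, (C (blockSign (r + 1) (wordDescent fun i => (v i : ℕ))) *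
      ∏ i, X (v i : ℕ) : MvPolynomial ℕ ℤ) = ∑ a : A, X (a : ℕ) ^ (r + 1) := by
  cases r with
  | zero =>
    rw [← (Equiv.funUnique (Fin 1) A).sum_comp]
    refine Finset.sum_congr rfl fun v _ => ?_
    have h : blockSign 1 (wordDescent fun i => (v i : ℕ)) = 1 := by
      rw [blockSign, if_pos fun j k h0 hjk hk => by omega, Finset.filter_eq_empty_iff.mpr]
      · simp
      · intro x _ hx
        rw [mem_Ioo] at hx
        omega
    simp [h]
  | succ r =>
    let p : (Fin (r + 2) → A) → MvPolynomial ℕ ℤ := fun v => ∏ i, X (v i : ℕ)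
    have hrot : ∑ v : Fin (r + 2) → A, C (blockTerm (Fin.init fun i => (v i : ℕ))
          (v (Fin.last _))) * p v =
        ∑ v : Fin (r + 2) → A, C (blockTerm (Fin.tail fun i => (v i : ℕ)) (v 0)) * p v := by
      rw [← (Equiv.arrowCongr (finRotate (r + 2)).symm (Equiv.refl A)).sum_comp]
      refine Finset.sum_congr rfl fun v _ => ?_
      have h1 : (Fin.init fun i => ((Equiv.arrowCongr (finRotate (r + 2)).symm (Equiv.refl A)) v i
          : ℕ)) = Fin.tail fun i => (v i : ℕ) := by
        funext i
        have : finRotate (r + 2) i.castSucc = i.succ := finRotate_of_lt i.2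
        simp [Fin.init, Fin.tail, this]
      have h2 : (Equiv.arrowCongr (finRotate (r + 2)).symm (Equiv.refl A)) v (Fin.last _) = v 0 := by
        simp
      have h3 : p ((Equiv.arrowCongr (finRotate (r + 2)).symm (Equiv.refl A)) v) = p v :=
        Equiv.prod_comp (finRotate (r + 2)) fun i => X (v i : ℕ)
      rw [h1, h2, h3]
    have hconst : ∑ v : Fin (r + 2) → A, C (if (fun i => (v i : ℕ)) = fun _ => (v 0 : ℕ) then 1
        else 0) * p v = ∑ a : A, X (a : ℕ) ^ (r + 2) := by
      have h1 : ∀ v : Fin (r + 2) → A, C (if (fun i => (v i : ℕ)) = fun _ => (v 0 : ℕ) then 1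
          else 0) * p v = if (fun i => (v i : ℕ)) = fun _ => (v 0 : ℕ) then p v else 0 :=
        fun v => by split_ifs <;> simp
      rw [Finset.sum_congr rfl fun v _ => h1 v, ← Finset.sum_filter]
      symm
      refine Finset.sum_nbij' (fun a _ => a) (fun v => v 0) (by simp) (by simp) (by simp) ?_ ?_
      · intro v hv
        have hv := (mem_filter.mp hv).2
        exact funext fun i => Subtype.ext (congrFun hv i).symm
      · intro a _
        simp [p]
    have hsplit : ∀ v : Fin (r + 2) → A,
        C (blockSign (r + 1 + 1) (wordDescent fun i => (v i : ℕ))) * ∏ i, X (v i : ℕ) =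
        C (if (fun i => (v i : ℕ)) = fun _ => (v 0 : ℕ) then 1 else 0) * p v +
          (C (blockTerm (Fin.init fun i => (v i : ℕ)) (v (Fin.last _))) * p v -
            C (blockTerm (Fin.tail fun i => (v i : ℕ)) (v 0)) * p v) := fun v => by
      rw [blockSign_wordDescent, C_sub, C_add]
      ring
    rw [Finset.sum_congr rfl fun v _ => hsplit v, Finset.sum_add_distrib, Finset.sum_sub_distrib,
      hrot, sub_self, add_zero, hconst]

open MvPolynomial in
theorem sum_unimodalSign_mul_prod (A : Finset ℕ) (α : List ℕ) (hα : ∀ a ∈ α, 0 < a) :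
    ∑ u : Fin α.sum → A, (C (unimodalSign α (wordDescent fun i => (u i : ℕ))) *
      ∏ i, X (u i : ℕ) : MvPolynomial ℕ ℤ) = (α.map fun a => ∑ x : A, X (x : ℕ) ^ a).prod := by
  induction α with
  | nil =>
    have h : ∀ u : Fin 0 → A, unimodalSign [] (wordDescent fun i => (u i : ℕ)) = 1 := fun u => by
      have : wordDescent (fun i => (u i : ℕ)) = ∅ :=
        Finset.subset_empty.mp (descentSet_subset _)
      have hU : AlphaUnimodal [] ↑(∅ : Finset ℕ) := fun j k _ hk => absurd hk (by simp)
      rw [this, unimodalSign, if_pos hU]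
      simp
    change ∑ u : Fin 0 → A, C (unimodalSign [] (wordDescent fun i => (u i : ℕ))) *
      ∏ i : Fin 0, X (u i : ℕ) = _
    simp [h]
  | cons a α ih =>
    have ih := ih fun b hb => hα b (List.mem_cons_of_mem a hb)
    obtain ⟨r, rfl⟩ : ∃ r, a = r + 1 := ⟨a - 1, by have := hα a (by simp); omega⟩
    rw [List.map_cons, List.prod_cons, ← ih, ← sum_blockSign_mul_prod, Finset.sum_mul_sum,
      ← Fintype.sum_prod_type']
    change ∑ u : Fin (r + 1 + α.sum) → A, _ = _
    rw [← (Fin.appendEquiv (r + 1) α.sum).sum_comp]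
    refine Finset.sum_congr rfl fun p _ => ?_
    obtain ⟨v, u⟩ := p
    have h1 : (fun i => ((Fin.append v u i : A) : ℕ)) =
        Fin.append (fun i => (v i : ℕ)) fun i => (u i : ℕ) := by
      funext i
      refine Fin.addCases (fun j => ?_) (fun j => ?_) i <;> simp
    change C (unimodalSign _ (wordDescent fun i => ((Fin.append v u i : A) : ℕ))) *
      ∏ i, X ((Fin.append v u i : A) : ℕ) = _
    rw [h1, unimodalSign_append, C_mul, Fin.prod_univ_add]
    simp only [Fin.append_left, Fin.append_right]
    ring

theorem sum_finset_words {n : ℕ} {M : Type*} [AddCommMonoid M] (F : (Fin n → ℕ) → M) (m : ℕ →₀ ℕ) :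
    (∑ u : Fin n → m.support, if content (fun i => (u i : ℕ)) = m then F (fun i => u i) else 0) =
      ∑ u ∈ withContent (Fin n) m, F u := by
  rw [← Finset.sum_filter]
  refine Finset.sum_bij (fun u _ i => (u i : ℕ)) ?_ ?_ ?_ ?_
  · intro u hu
    exact mem_withContent.mpr (mem_filter.mp hu).2
  · intro u _ v _ h
    exact funext fun i => Subtype.ext (congrFun h i)
  · intro u hu
    have hu := mem_withContent.mp hu
    refine ⟨fun i => ⟨u i, hu ▸ mem_support_content u i⟩, ?_, rfl⟩
    simpa using hu
  · exact fun _ _ => rfl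

open MvPolynomial in
theorem powerSumCoeff_eq (α : List ℕ) (hα : ∀ a ∈ α, 0 < a) (m : ℕ →₀ ℕ) :
    powerSumCoeff α m = ∑ u ∈ withContent (Fin α.sum) m, unimodalSign α (wordDescent u) := by
  have hX : ∀ x k, (X x : MvPolynomial ℕ ℤ) ^ k = monomial (Finsupp.single x k) 1 := fun x k => by
    rw [X_pow_eq_monomial]
  have h := congrArg (coeff m) (sum_unimodalSign_mul_prod m.support α hα)
  have hL : coeff m (∑ u : Fin α.sum → m.support,
      (C (unimodalSign α (wordDescent fun i => (u i : ℕ))) * ∏ i, X (u i : ℕ) :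
        MvPolynomial ℕ ℤ)) = ∑ u ∈ withContent (Fin α.sum) m, unimodalSign α (wordDescent u) := by
    rw [← sum_finset_words, coeff_sum]
    refine Finset.sum_congr rfl fun u _ => ?_
    have : (∏ i, X (u i : ℕ) : MvPolynomial ℕ ℤ) = monomial (content fun i => (u i : ℕ)) 1 := by
      rw [content, monomial_sum_one]
      rfl
    rw [coeff_C_mul, this, coeff_monomial, mul_ite, mul_one, mul_zero]
  have hR : coeff m (α.map fun a => ∑ x : m.support, (X (x : ℕ) : MvPolynomial ℕ ℤ) ^ a).prod =
      powerSumCoeff α m := by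
    rw [← Fin.prod_univ_fun_getElem, Finset.prod_univ_sum, coeff_sum, powerSumCoeff]
    have h1 : ∀ g : Fin α.length → m.support, coeff m (∏ j, (X (g j : ℕ) : MvPolynomial ℕ ℤ) ^
        α[(j : ℕ)]) = if ∑ j, Finsupp.single (g j : ℕ) (α.get j) = m then 1 else 0 := fun g => by
      simp only [hX]
      rw [← monomial_sum_one, coeff_monomial]
      rfl
    rw [Fintype.piFinset_univ, Finset.sum_congr rfl fun g _ => h1 g, Finset.sum_boole,
      ← Set.ncard_coe_finset]
    congr 1
    refine Set.ncard_congr (fun g _ j => (g j : ℕ)) ?_ ?_ ?_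
    · intro g hg
      simpa using hg
    · intro g g' _ _ h
      exact funext fun i => Subtype.ext (congrFun h i)
    · intro g hg
      have hmem : ∀ j, g j ∈ m.support := fun j => by
        rw [← show _ = m from hg, Finsupp.mem_support_iff, Finsupp.finsetSum_apply]
        refine (Finset.sum_pos' (fun _ _ => Nat.zero_le _) ⟨j, mem_univ j, ?_⟩).ne'
        rw [Finsupp.single_eq_same]
        exact hα _ (List.get_mem α j)
      exact ⟨fun j => ⟨g j, hmem j⟩, by simpa using hg, rfl⟩
  rw [← hR, ← h, hL]

theorem Matrix.exists_eq_sum_of_det_ne_zero {ι : Type*} [Fintype ι] [DecidableEq ι]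
    {M : Matrix ι ι ℚ} (hM : M.det ≠ 0) (v : ι → ℚ) : ∃ y : ι → ℚ, ∀ i, v i = ∑ j, y j * M i j := by
  refine ⟨M⁻¹.mulVec v, fun i => ?_⟩
  have h : M.mulVec (M⁻¹.mulVec v) = v := by
    rw [Matrix.mulVec_mulVec, Matrix.mul_nonsing_inv _ (isUnit_iff_ne_zero.mpr hM),
      Matrix.one_mulVec]
  conv_lhs => rw [← h]
  exact Finset.sum_congr rfl fun j _ => mul_comm _ _

theorem le_iff_lt_sum_of_monotone {n : ℕ} {f : Fin n → ℕ} (hf : Monotone f) (k : Fin n) (a : ℕ) :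
    f k ≤ a ↔ (k : ℕ) < ∑ x, if f x ≤ a then 1 else 0 := by
  rw [← Finset.card_filter]
  constructor
  · intro h
    have := Finset.card_le_card (s := Iic k) (t := univ.filter fun x => f x ≤ a) fun x hx => by
      simpa using (hf (mem_Iic.mp hx)).trans h
    rw [Fin.card_Iic] at this
    omega
  · intro h
    by_contra hc
    have := Finset.card_le_card (s := univ.filter fun x => f x ≤ a) (t := Iio k) fun x hx => by
      rw [mem_Iio]
      by_contra hx'
      have := hf (not_lt.mp hx')
      have := (mem_filter.mp hx).2
      omega
    rw [Fin.card_Iio] at this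
    omega

/-- A monotone word is determined by its content. -/
theorem eq_of_monotone_of_content_eq {n : ℕ} {f g : Fin n → ℕ} (hf : Monotone f) (hg : Monotone g)
    (h : content f = content g) : f = g := by
  have hle : ∀ k a, f k ≤ a ↔ g k ≤ a := fun k a => by
    rw [le_iff_lt_sum_of_monotone hf, le_iff_lt_sum_of_monotone hg,
      sum_comp_of_content_eq h fun b => if b ≤ a then 1 else 0]
  exact funext fun k => le_antisymm ((hle k _).mpr le_rfl) ((hle k _).mp le_rfl)

/-- The monotone word that increases exactly at the positions in `T`. -/
noncomputable def stepWord (n : ℕ) (T : Finset ℕ) (k : Fin n) : ℕ :=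
  (T.filter (· ≤ (k : ℕ))).card

theorem monotone_stepWord (n : ℕ) (T : Finset ℕ) : Monotone (stepWord n T) := fun j k hjk =>
  Finset.card_le_card fun x hx => by
    rw [mem_filter] at hx ⊢
    exact ⟨hx.1, hx.2.trans hjk⟩

theorem stepWord_lt_iff {n : ℕ} {T : Finset ℕ} {j k : Fin n} (h : (j : ℕ) + 1 = k) :
    stepWord n T j < stepWord n T k ↔ (j : ℕ) + 1 ∈ T := by
  have hsub : T.filter (· ≤ (j : ℕ)) ⊆ T.filter (· ≤ (k : ℕ)) := fun x hx => by
    rw [mem_filter] at hx ⊢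
    exact ⟨hx.1, by omega⟩
  constructor
  · intro hlt
    obtain ⟨x, hx, hx'⟩ := Finset.exists_mem_notMem_of_card_lt_card hlt
    rw [mem_filter] at hx hx'
    have : x = (j : ℕ) + 1 := by
      have : ¬ x ≤ (j : ℕ) := fun h => hx' ⟨hx.1, h⟩
      have := hx.2
      omega
    exact this ▸ hx.1
  · intro hT
    refine Finset.card_lt_card (Finset.ssubset_iff_of_subset hsub |>.mpr ⟨j + 1, ?_, ?_⟩)
    · rw [mem_filter]
      exact ⟨hT, h.le⟩
    · simp

theorem fqsymCoeff_stepWord_self_ne_zero (n : ℕ) (T : Finset ℕ) :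
    fqsymCoeff n ↑T (content (stepWord n T)) ≠ 0 := by
  rw [fqsymCoeff_eq_ncard]
  refine ((Set.ncard_pos ((finite_content_eq (content (stepWord n T))).subset
    fun f h => h.2.2)).mpr ⟨stepWord n T, ?_⟩).ne'
  exact ⟨monotone_stepWord n T, fun j k hjk hT => (stepWord_lt_iff hjk).mpr hT, rfl⟩

theorem subset_of_fqsymCoeff_stepWord_ne_zero {n : ℕ} {S T : Finset ℕ} (hS : S ⊆ Icc 1 (n - 1))
    (h : fqsymCoeff n ↑S (content (stepWord n T)) ≠ 0) : S ⊆ T := by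
  rw [fqsymCoeff_eq_ncard] at h
  obtain ⟨f, hf, hs, hc⟩ := Set.nonempty_of_ncard_ne_zero h
  obtain rfl := eq_of_monotone_of_content_eq hf (monotone_stepWord n T) hc
  intro s hs'
  have hmem := mem_Icc.mp (hS hs')
  have hsucc : s - 1 + 1 = s := by omega
  have hj : ((⟨s - 1, by omega⟩ : Fin n) : ℕ) + 1 = (⟨s, by omega⟩ : Fin n) := hsucc
  have := (stepWord_lt_iff hj).mp (hs _ _ hj (by simpa only [hsucc, mem_coe] using hs'))
  simpa only [hsucc] using this

theorem exists_eq_sum_fqsymCoeff (n : ℕ) (v : Finset ℕ → ℚ) :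
    ∃ y : ↥((Icc 1 (n - 1)).powerset) → ℚ, ∀ S ⊆ Icc 1 (n - 1),
      v S = ∑ T, y T * fqsymCoeff n ↑S (content (stepWord n T.1)) := by
  let M : Matrix ↥((Icc 1 (n - 1)).powerset) ↥((Icc 1 (n - 1)).powerset) ℚ := fun S T =>
    fqsymCoeff n ↑S.1 (content (stepWord n T.1))
  have hM : M.det ≠ 0 := by
    refine Matrix.det_ne_zero_of_triangular (fun S => S.1.card) M
      (fun S => Nat.cast_ne_zero.mpr (fqsymCoeff_stepWord_self_ne_zero n S.1)) fun S T hne h => ?_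
    have := subset_of_fqsymCoeff_stepWord_ne_zero (mem_powerset.mp S.2) (Nat.cast_ne_zero.mp h)
    exact Finset.card_lt_card (this.ssubset_of_ne fun h' => hne (Subtype.ext h'))
  obtain ⟨y, hy⟩ := Matrix.exists_eq_sum_of_det_ne_zero hM fun S => v S.1
  exact ⟨y, fun S hS => hy ⟨S, mem_powerset.mpr hS⟩⟩

theorem exists_composition (n : ℕ) (hn : 0 < n) (T : Finset ℕ) (hT : T ⊆ Icc 1 (n - 1)) :
    ∃ α : List ℕ, (∀ a ∈ α, 0 < a) ∧ α.sum = n ∧ partialSums α = insert n (T : Set ℕ) := by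
  induction n using Nat.strong_induction_on generalizing T with
  | _ n ih =>
    rcases T.eq_empty_or_nonempty with rfl | hne
    · refine ⟨[n], by simpa, by simp, ?_⟩
      ext x
      rw [mem_partialSums_cons]
      simp [partialSums]
    · let a := T.min' hne
      have haT : a ∈ T := T.min'_mem hne
      have ha := mem_Icc.mp (hT haT)
      have hsub : shiftSet a T ⊆ Icc 1 (n - a - 1) := fun j hj => by
        rw [mem_shiftSet] at hj
        have := mem_Icc.mp (hT hj.2)
        rw [mem_Icc]
        omega
      obtain ⟨α, hpos, hsum, hps⟩ := ih (n - a) (by omega) (by omega) _ hsub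
      refine ⟨a :: α, ?_, by rw [List.sum_cons, hsum]; omega, ?_⟩
      · rintro b hb
        rcases List.mem_cons.mp hb with rfl | hb
        exacts [ha.1, hpos b hb]
      · ext x
        rw [mem_partialSums_cons, hps]
        simp only [Set.mem_insert_iff, mem_coe, mem_shiftSet]
        constructor
        · rintro (rfl | ⟨y, rfl | ⟨-, hy⟩, rfl⟩)
          · exact Or.inr haT
          · exact Or.inl (by omega)
          · exact Or.inr hy
        · rintro (rfl | hx)
          · exact Or.inr ⟨x - a, Or.inl rfl, by omega⟩
          · rcases (T.min'_le x hx).eq_or_lt with h | h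
            · exact Or.inl h.symm
            · have h : a < x := h
              exact Or.inr ⟨x - a, Or.inr ⟨by omega, by rwa [Nat.add_sub_cancel' h.le]⟩, by omega⟩

theorem notMem_partialSums {α : List ℕ} {i x : ℕ} (h1 : (α.take i).sum < x)
    (h2 : x < (α.take (i + 1)).sum) : x ∉ partialSums α := by
  rintro ⟨l, -, rfl⟩
  rcases Nat.lt_or_ge l i with h | h
  · exact absurd (List.monotone_sum_take α (show l + 1 ≤ i from h)) (not_le.mpr h1)
  · exact absurd (List.monotone_sum_take α (show i + 1 ≤ l + 1 by omega)) (not_le.mpr h2)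

theorem unimodalSign_insert {α : List ℕ} {t : ℕ} (ht : t ∈ partialSums α) (S : Finset ℕ) :
    unimodalSign α (insert t S) = unimodalSign α S := by
  have h1 : AlphaUnimodal α ↑(insert t S) ↔ AlphaUnimodal α ↑S := by
    refine forall_congr' fun j => forall_congr' fun k => forall_congr' fun hjk => ?_
    have hj : ∀ x, (∃ i < α.length, (α.take i).sum < x ∧ x < (α.take (i + 1)).sum) →
        (x ∈ (↑(insert t S) : Set ℕ) ↔ x ∈ (↑S : Set ℕ)) := by
      rintro x ⟨i, -, h1, h2⟩
      have : x ≠ t := by rintro rfl; exact notMem_partialSums h1 h2 ht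
      simp [this]
    constructor
    · rintro H hk ⟨i, hi, h1, h2⟩
      exact (hj j ⟨i, hi, h1, by omega⟩).mp
        (H ((hj k ⟨i, hi, by omega, h2⟩).mpr hk) ⟨i, hi, h1, h2⟩)
    · rintro H hk ⟨i, hi, h1, h2⟩
      exact (hj j ⟨i, hi, h1, by omega⟩).mpr
        (H ((hj k ⟨i, hi, by omega, h2⟩).mp hk) ⟨i, hi, h1, h2⟩)
  have h2 : (↑(insert t S) : Set ℕ) \ partialSums α = ↑S \ partialSums α := by
    rw [Finset.coe_insert, Set.insert_sdiff_of_mem _ ht]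
  simp only [unimodalSign, h1, h2]

/-- The signed count of the supersets of `R`, as a function of `S`. -/
noncomputable def supersetSign (R S : Finset ℕ) : ℤ :=
  if R ⊆ S then (-1) ^ (S \ R).card else 0

theorem supersetSign_insert {R S : Finset ℕ} {t : ℕ} (hR : t ∉ R) (hS : t ∉ S) :
    supersetSign R (insert t S) = -supersetSign R S := by
  simp only [supersetSign, Finset.subset_insert_iff_of_notMem hR]
  rw [Finset.insert_sdiff_of_notMem _ hR, Finset.card_insert_of_notMem (by simp [hS]), pow_succ]
  split_ifs <;> simp

theorem sum_unimodalSign_mul_supersetSign_eq_zero {E R : Finset ℕ} {α : List ℕ} {t : ℕ}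
    (htE : t ∈ E) (ht : t ∈ partialSums α) (hR : t ∉ R) :
    ∑ S ∈ E.powerset, unimodalSign α S * supersetSign R S = 0 := by
  rw [← Finset.insert_erase htE, Finset.sum_powerset_insert (Finset.notMem_erase t E),
    ← Finset.sum_add_distrib]
  refine Finset.sum_eq_zero fun S hS => ?_
  rw [unimodalSign_insert ht, supersetSign_insert hR fun h =>
    Finset.notMem_erase t E (mem_powerset.mp hS h)]
  ring

theorem sum_unimodalSign_mul_supersetSign_ne_zero {n : ℕ} {α : List ℕ} {T : Finset ℕ} (hn : 0 < n)
    (hT : T ⊆ Icc 1 (n - 1)) (hα : partialSums α = insert n (T : Set ℕ)) :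
    ∑ S ∈ (Icc 1 (n - 1)).powerset, unimodalSign α S * supersetSign T S ≠ 0 := by
  have hterm : ∀ S ∈ (Icc 1 (n - 1)).powerset, unimodalSign α S * supersetSign T S =
      if AlphaUnimodal α ↑S ∧ T ⊆ S then 1 else 0 := by
    intro S hS
    have hcard : ((↑S : Set ℕ) \ partialSums α).ncard = (S \ T).card := by
      rw [← Set.ncard_coe_finset, hα]
      congr 1
      ext x
      have : x ∈ S → x ≠ n := fun hx => by
        have := mem_Icc.mp (mem_powerset.mp hS hx)
        omega
      simp only [Set.mem_sdiff, mem_coe, Set.mem_insert_iff, mem_sdiff]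
      tauto
    rw [unimodalSign, supersetSign, hcard]
    by_cases h1 : AlphaUnimodal α ↑S
    · by_cases h2 : T ⊆ S
      · rw [if_pos h1, if_pos h2, if_pos ⟨h1, h2⟩, ← mul_pow]
        simp
      · rw [if_neg h2, if_neg (not_and_of_not_right _ h2), mul_zero]
    · rw [if_neg h1, if_neg (not_and_of_not_left _ h1), zero_mul]
  rw [Finset.sum_congr rfl hterm]
  refine (Finset.sum_pos' (fun S _ => by split_ifs <;> simp)
    ⟨T, mem_powerset.mpr hT, ?_⟩).ne'
  rw [if_pos]
  · exact one_pos
  · refine ⟨?_, subset_rfl⟩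
    rintro j k hjk hk ⟨i, -, h1, h2⟩
    exact absurd (hα ▸ Set.mem_insert_of_mem n hk) (notMem_partialSums (hjk.trans' h1) h2)

theorem exists_eq_sum_unimodalSign {n : ℕ} (hn : 0 < n) (v : Finset ℕ → ℚ) :
    ∃ (α : ↥((Icc 1 (n - 1)).powerset) → List ℕ) (y : ↥((Icc 1 (n - 1)).powerset) → ℚ),
      (∀ T, (∀ a ∈ α T, 0 < a) ∧ (α T).sum = n) ∧ ∀ S ⊆ Icc 1 (n - 1),
        v S = ∑ T, y T * unimodalSign (α T) S := by
  choose α hpos hsum hps using fun T : ↥((Icc 1 (n - 1)).powerset) =>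
    exists_composition n hn T.1 (mem_powerset.mp T.2)
  let M : Matrix ↥((Icc 1 (n - 1)).powerset) ↥((Icc 1 (n - 1)).powerset) ℚ := fun S T =>
    unimodalSign (α T) S.1
  let U : Matrix ↥((Icc 1 (n - 1)).powerset) ↥((Icc 1 (n - 1)).powerset) ℚ := fun S R =>
    supersetSign R.1 S.1
  have hMU : ∀ T R, (M.transpose * U) T R = ((∑ S ∈ (Icc 1 (n - 1)).powerset,
      unimodalSign (α T) S * supersetSign R.1 S : ℤ) : ℚ) := fun T R => by
    rw [Matrix.mul_apply, Int.cast_sum, ← Finset.sum_coe_sort (Icc 1 (n - 1)).powerset]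
    exact Finset.sum_congr rfl fun S _ => (Int.cast_mul _ _).symm
  have hM : M.det ≠ 0 := by
    have : (M.transpose * U).det ≠ 0 := by
      refine Matrix.det_ne_zero_of_triangular (fun S => S.1.card) _ (fun T => ?_) fun T R hne h => ?_
      · rw [hMU]
        exact Int.cast_ne_zero.mpr
          (sum_unimodalSign_mul_supersetSign_ne_zero hn (mem_powerset.mp T.2) (hps T))
      · rw [hMU] at h
        have hsub : T.1 ⊆ R.1 := fun t ht => by
          by_contra hR
          exact h (Int.cast_eq_zero.mpr (sum_unimodalSign_mul_supersetSign_eq_zero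
            (mem_powerset.mp T.2 ht) (hps T ▸ Set.mem_insert_of_mem n ht) hR))
        exact Finset.card_lt_card (hsub.ssubset_of_ne fun h' => hne (Subtype.ext h'))
    rw [Matrix.det_mul, Matrix.det_transpose] at this
    exact left_ne_zero_of_mul this
  obtain ⟨y, hy⟩ := Matrix.exists_eq_sum_of_det_ne_zero hM fun S => v S.1
  exact ⟨α, y, fun T => ⟨hpos T, hsum T⟩, fun S hS => hy ⟨S, mem_powerset.mpr hS⟩⟩

theorem finite_youngDiagram_card_eq (n : ℕ) : Finite {μ : YoungDiagram // μ.cells.card = n} := by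
  have hsub : ∀ μ : {μ : YoungDiagram // μ.cells.card = n},
      μ.1.cells ∈ (range n ×ˢ range n).powerset := by
    rintro ⟨μ, rfl⟩
    refine mem_powerset.mpr fun c hc => ?_
    have h1 : ((range (c.1 + 1)).image fun i => (i, c.2)) ⊆ μ.cells := fun x hx => by
      obtain ⟨i, hi, rfl⟩ := mem_image.mp hx
      exact μ.up_left_mem (by simpa [Nat.lt_succ_iff] using hi) le_rfl hc
    have h2 : ((range (c.2 + 1)).image fun j => (c.1, j)) ⊆ μ.cells := fun x hx => by
      obtain ⟨j, hj, rfl⟩ := mem_image.mp hx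
      exact μ.up_left_mem le_rfl (by simpa [Nat.lt_succ_iff] using hj) hc
    have h1 := Finset.card_le_card h1
    have h2 := Finset.card_le_card h2
    rw [card_image_of_injective _ fun i j h => congrArg Prod.fst h, card_range] at h1
    rw [card_image_of_injective _ fun i j h => congrArg Prod.snd h, card_range] at h2
    exact mem_product.mpr ⟨mem_range.mpr h1, mem_range.mpr h2⟩
  exact Finite.of_injective (fun μ => (⟨μ.1.cells, hsub μ⟩ : ↥(range n ×ˢ range n).powerset))
    fun μ ν h => Subtype.ext (YoungDiagram.ext (congrArg Subtype.val h))

/-- The sum over standard listings of the cells of `μ` of a function of the descent set. -/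
noncomputable def tableauSum (n : ℕ) (μ : YoungDiagram) (v : Finset ℕ → ℚ) : ℚ :=
  ∑ e : Fin n ≃ μ.cells with IsStandardListing μ e,
    v (descentSet fun j k => (e k).1.2 ≤ (e j).1.2)

theorem tableauSum_fqsymCoeff {n : ℕ} {μ : YoungDiagram} (hμ : μ.cells.card = n) (m : ℕ →₀ ℕ) :
    tableauSum n μ (fun S => fqsymCoeff n ↑S m) = schurCoeff μ m := by
  rw [schurCoeff_eq_sum_fqsymCoeff hμ, Nat.cast_sum, tableauSum]

theorem tableauSum_fqsymCoeff_sdiff {n : ℕ} {μ : YoungDiagram} (hμ : μ.cells.card = n)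
    (m : ℕ →₀ ℕ) : tableauSum n μ (fun S => fqsymCoeff n ↑(Icc 1 (n - 1) \ S) m) =
      schurCoeff μ.transpose m := by
  rw [schurCoeff_transpose hμ, Nat.cast_sum, tableauSum]

section Linear

variable {ι : Type*} [Fintype ι] {n : ℕ} {v : Finset ℕ → ℚ} {y : ι → ℚ} {w : ι → Finset ℕ → ℚ}

theorem tableauSum_linear (h : ∀ S ⊆ Icc 1 (n - 1), v S = ∑ T, y T * w T S) (μ : YoungDiagram) :
    tableauSum n μ v = ∑ T, y T * tableauSum n μ (w T) := by
  simp only [tableauSum, Finset.mul_sum]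
  rw [Finset.sum_comm]
  exact Finset.sum_congr rfl fun e _ => h _ (descentSet_subset _)

theorem descentForm_linear (h : ∀ S ⊆ Icc 1 (n - 1), v S = ∑ T, y T * w T S)
    (v' : Finset ℕ → ℚ) : descentForm n v v' = ∑ T, y T * descentForm n (w T) v' := by
  simp only [descentForm, Finset.mul_sum]
  rw [Finset.sum_comm]
  refine Finset.sum_congr rfl fun σ _ => ?_
  rw [h (permDescent σ.symm) (descentSet_subset _), Finset.sum_mul]
  exact Finset.sum_congr rfl fun T _ => mul_assoc _ _ _

theorem descentForm_linear_right (h : ∀ S ⊆ Icc 1 (n - 1), v S = ∑ T, y T * w T S)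
    (v' : Finset ℕ → ℚ) : descentForm n v' v = ∑ T, y T * descentForm n v' (w T) := by
  rw [descentForm_comm, descentForm_linear h]
  exact Finset.sum_congr rfl fun T _ => by rw [descentForm_comm]

theorem sum_tableauSum_eq_of_linear {P B : Type*} [Fintype P] [Fintype B]
    (h : ∀ S ⊆ Icc 1 (n - 1), v S = ∑ T, y T * w T S) (μ : P → YoungDiagram) (c : P → ℚ)
    (Des : B → Finset ℕ) (hDes : ∀ b, Des b ⊆ Icc 1 (n - 1))
    (hw : ∀ T, ∑ p, c p * tableauSum n (μ p) (w T) = ∑ b, w T (Des b)) :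
    ∑ p, c p * tableauSum n (μ p) v = ∑ b, v (Des b) := by
  calc ∑ p, c p * tableauSum n (μ p) v
      = ∑ T, y T * ∑ p, c p * tableauSum n (μ p) (w T) := by
        simp only [tableauSum_linear h, Finset.mul_sum]
        rw [Finset.sum_comm]
        exact Finset.sum_congr rfl fun p _ => Finset.sum_congr rfl fun T _ => mul_left_comm _ _ _
    _ = ∑ b, v (Des b) := by
        simp only [hw, Finset.mul_sum]
        rw [Finset.sum_comm]
        exact Finset.sum_congr rfl fun b _ => (h _ (hDes b)).symm

end Linear

/-- The values of the irreducible characters given by the Frobenius formula are the signed counts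
of standard tableaux with unimodal descent sets. -/
theorem tableauSum_unimodalSign {n : ℕ} (hn : 0 < n)
    [Fintype {μ : YoungDiagram // μ.cells.card = n}]
    (χ : {μ : YoungDiagram // μ.cells.card = n} → List ℕ → ℚ)
    (hχ : ∀ α : List ℕ, (∀ a ∈ α, 0 < a) → α.sum = n → ∀ m : ℕ →₀ ℕ,
      descentForm n (fun S => unimodalSign α S) (fun S => fqsymCoeff n ↑S m) =
        ∑ μ, χ μ α * schurCoeff μ.1 m)
    {α : List ℕ} (hα : ∀ a ∈ α, 0 < a) (hsum : α.sum = n)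
    (μ : {μ : YoungDiagram // μ.cells.card = n}) :
    tableauSum n μ.1 (fun S => unimodalSign α S) = χ μ α := by
  have hform : ∀ α : List ℕ, (∀ a ∈ α, 0 < a) → α.sum = n → ∀ v : Finset ℕ → ℚ,
      descentForm n (fun S => unimodalSign α S) v = ∑ μ, χ μ α * tableauSum n μ.1 v := by
    intro α hα hsum v
    obtain ⟨y, hy⟩ := exists_eq_sum_fqsymCoeff n v
    rw [descentForm_linear_right hy]
    simp only [hχ α hα hsum, tableauSum_linear hy, Finset.mul_sum]
    rw [Finset.sum_comm]
    refine Finset.sum_congr rfl fun μ _ => Finset.sum_congr rfl fun T _ => ?_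
    rw [tableauSum_fqsymCoeff μ.2]
    ring
  let r : {μ : YoungDiagram // μ.cells.card = n} → ℕ := fun μ => rowSum μ.1
  let H : {μ : YoungDiagram // μ.cells.card = n} → Finset ℕ → ℚ := fun ν S =>
    fqsymCoeff n ↑S (rowContent ν.1)
  let E : {μ : YoungDiagram // μ.cells.card = n} → Finset ℕ → ℚ := fun κ S =>
    fqsymCoeff n ↑(Icc 1 (n - 1) \ S) (rowContent κ.1.transpose)
  let K : Matrix {μ : YoungDiagram // μ.cells.card = n} {μ : YoungDiagram // μ.cells.card = n} ℚ :=
    fun μ ν => tableauSum n μ.1 (H ν)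
  let D : Matrix {μ : YoungDiagram // μ.cells.card = n} {μ : YoungDiagram // μ.cells.card = n} ℚ :=
    fun κ μ => tableauSum n μ.1 (E κ)
  let N : Matrix {μ : YoungDiagram // μ.cells.card = n} {μ : YoungDiagram // μ.cells.card = n} ℚ :=
    fun κ ν => descentForm n (E κ) (H ν)
  have hK : K.IsUnitri r := by
    refine ⟨fun μ => ?_, fun μ ν hne h => ?_⟩
    · rw [show K μ μ = _ from tableauSum_fqsymCoeff μ.2 _, schurCoeff_rowContent_self, Nat.cast_one]
    · rw [show K μ ν = _ from tableauSum_fqsymCoeff μ.2 _] at h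
      exact rowSum_lt_of_schurCoeff_ne_zero (fun h' => hne (Subtype.ext h')) (Nat.cast_ne_zero.mp h)
  have hD : D.IsUnitri r := by
    refine ⟨fun μ => ?_, fun κ μ hne h => ?_⟩
    · rw [show D μ μ = _ from tableauSum_fqsymCoeff_sdiff μ.2 _, schurCoeff_rowContent_self,
        Nat.cast_one]
    · rw [show D κ μ = _ from tableauSum_fqsymCoeff_sdiff μ.2 _] at h
      exact rowSum_lt_of_schurCoeff_transpose_ne_zero (μ.2.trans κ.2.symm)
        (fun h' => hne (Subtype.ext h')) (Nat.cast_ne_zero.mp h)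
  have hN : N.IsUnitri r := by
    have hNw : ∀ κ ν, N κ ν = ∑ u ∈ withContent (Fin n) (rowContent ν.1), E κ (wordDescent u) :=
      fun κ ν => (sum_wordDescent_eq (E κ) (rowContent ν.1)).symm
    refine ⟨fun κ => (hNw κ κ).trans (sum_wordDescent_self κ.2), fun κ ν hne h => ?_⟩
    rw [hNw] at h
    exact rowSum_lt_of_sum_wordDescent_ne_zero κ.2 (fun h' => hne (Subtype.ext h')) h
  choose β y hβ hy using fun ν => exists_eq_sum_unimodalSign hn (H ν)
  let Y : Matrix {μ : YoungDiagram // μ.cells.card = n} {μ : YoungDiagram // μ.cells.card = n} ℚ :=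
    fun μ ν => ∑ T, y ν T * χ μ (β ν T)
  have hformH : ∀ ν v, descentForm n (H ν) v = ∑ μ, Y μ ν * tableauSum n μ.1 v := by
    intro ν v
    rw [descentForm_linear (w := fun T S => (unimodalSign (β ν T) S : ℚ)) (hy ν)]
    simp only [Y, hform _ (hβ ν _).1 (hβ ν _).2, Finset.mul_sum, Finset.sum_mul]
    rw [Finset.sum_comm]
    exact Finset.sum_congr rfl fun μ _ => Finset.sum_congr rfl fun T _ => (mul_assoc _ _ _).symm
  have hDY : D * Y = N := by
    ext κ ν
    rw [Matrix.mul_apply, show N κ ν = _ from descentForm_comm _ _ _, hformH]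
    exact Finset.sum_congr rfl fun μ _ => mul_comm _ _
  have hYK : Y = K := by
    refine hK.eq_of_transpose_mul_eq (hD.of_mul_eq hN hDY) ?_
    ext κ ν
    rw [Matrix.mul_apply, Matrix.mul_apply]
    have := descentForm_comm n (H κ) (H ν)
    rw [hformH, hformH] at this
    exact this.trans (Finset.sum_congr rfl fun μ _ => mul_comm _ _)
  let δ : {μ : YoungDiagram // μ.cells.card = n} → ℚ := fun μ =>
    tableauSum n μ.1 (fun S => unimodalSign α S) - χ μ α
  have hδ : K.transpose.mulVec δ = 0 := by
    ext ν
    have := descentForm_comm n (fun S => unimodalSign α S) (H ν)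
    rw [hform α hα hsum, hformH, hYK] at this
    simp only [Matrix.mulVec, dotProduct, Matrix.transpose_apply, δ, mul_sub,
      Finset.sum_sub_distrib, Pi.zero_apply]
    rw [← this, sub_eq_zero]
    exact Finset.sum_congr rfl fun μ _ => mul_comm _ _
  have := Matrix.eq_zero_of_mulVec_eq_zero (by
    rw [Matrix.det_transpose]; exact hK.det_ne_zero) hδ
  exact sub_eq_zero.mp (congrFun this μ)

/-- Let `χ = Σ_λ c_λ χ^λ` be a character of `S_n` (so `c : multiplicities in ℕ`, the
irreducible characters `χirr` being characterized by the Frobenius formula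
`p_α = Σ_λ χ^λ(α) s_λ`), and let `B` be a finite set equipped with a descent map
`Des : B → 2^{[n−1]}`.  Then `B` is a fine set for `χ`, i.e.
`χ(α) = Σ_{b ∈ B, Des(b) α-unimodal} (−1)^{|Des(b) \ S(α)|}` for every composition `α`
of `n`, if and only if the Frobenius characteristic of `χ`, namely `Σ_λ c_λ s_λ`,
equals `Σ_{b ∈ B} F_{n, Des(b)}(x)`. -/
theorem fine_set_iff_frobenius_char (n : ℕ) (hn : 0 < n)
    (χirr : YoungDiagram → List ℕ → ℤ)
    (hFrob : ∀ α : List ℕ, (∀ a ∈ α, 0 < a) → α.sum = n → ∀ m : ℕ →₀ ℕ,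
      powerSumCoeff α m
        = ∑ᶠ μ : { μ : YoungDiagram // μ.cells.card = n },
            χirr μ.1 α * (schurCoeff μ.1 m : ℤ))
    (c : YoungDiagram → ℕ)
    (B : Type*) [Fintype B] (Des : B → Finset ℕ)
    (hDes : ∀ b, Des b ⊆ Finset.Icc 1 (n - 1)) :
    (∀ α : List ℕ, (∀ a ∈ α, 0 < a) → α.sum = n →
        (∑ᶠ μ : { μ : YoungDiagram // μ.cells.card = n }, (c μ.1 : ℤ) * χirr μ.1 α)
          = ∑ b : B, if AlphaUnimodal α ↑(Des b)
              then (-1 : ℤ) ^ ((↑(Des b) : Set ℕ) \ partialSums α).ncard else 0)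
      ↔ (∀ m : ℕ →₀ ℕ,
          (∑ᶠ μ : { μ : YoungDiagram // μ.cells.card = n },
              (c μ.1 : ℤ) * (schurCoeff μ.1 m : ℤ))
            = ∑ b : B, (fqsymCoeff n ↑(Des b) m : ℤ)) := by
  have := finite_youngDiagram_card_eq n
  have := Fintype.ofFinite {μ : YoungDiagram // μ.cells.card = n}
  have hχ : ∀ α : List ℕ, (∀ a ∈ α, 0 < a) → α.sum = n → ∀ m : ℕ →₀ ℕ,
      descentForm n (fun S => unimodalSign α S) (fun S => fqsymCoeff n ↑S m) =
        ∑ μ : {μ : YoungDiagram // μ.cells.card = n}, (χirr μ.1 α : ℚ) * schurCoeff μ.1 m := by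
    intro α hα hsum m
    have h := hFrob α hα hsum m
    rw [finsum_eq_sum_of_fintype, powerSumCoeff_eq α hα, hsum] at h
    have h := congrArg (Int.cast : ℤ → ℚ) h
    push_cast at h
    rw [← h]
    exact (sum_wordDescent_eq (fun S => (unimodalSign α S : ℚ)) m).symm
  have key : ∀ α : List ℕ, (∀ a ∈ α, 0 < a) → α.sum = n →
      ∀ μ : {μ : YoungDiagram // μ.cells.card = n},
        tableauSum n μ.1 (fun S => unimodalSign α S) = χirr μ.1 α := fun α hα hsum μ =>
    tableauSum_unimodalSign hn (fun μ α => (χirr μ.1 α : ℚ)) hχ hα hsum μ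
  have hl : ∀ α : List ℕ, (∀ a ∈ α, 0 < a) → α.sum = n →
      (((∑ᶠ μ : {μ : YoungDiagram // μ.cells.card = n}, (c μ.1 : ℤ) * χirr μ.1 α) =
        ∑ b : B, unimodalSign α (Des b)) ↔
      ∑ μ : {μ : YoungDiagram // μ.cells.card = n},
          (c μ.1 : ℚ) * tableauSum n μ.1 (fun S => unimodalSign α S) =
        ∑ b : B, (unimodalSign α (Des b) : ℚ)) := by
    intro α hα hsum
    rw [finsum_eq_sum_of_fintype]
    simp only [key α hα hsum]
    exact_mod_cast Iff.rfl
  have hr : ∀ m : ℕ →₀ ℕ,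
      ((∑ᶠ μ : {μ : YoungDiagram // μ.cells.card = n}, (c μ.1 : ℤ) * (schurCoeff μ.1 m : ℤ)) =
        ∑ b : B, (fqsymCoeff n ↑(Des b) m : ℤ)) ↔
      ∑ μ : {μ : YoungDiagram // μ.cells.card = n},
          (c μ.1 : ℚ) * tableauSum n μ.1 (fun S => fqsymCoeff n ↑S m) =
        ∑ b : B, (fqsymCoeff n ↑(Des b) m : ℚ) := by
    intro m
    rw [finsum_eq_sum_of_fintype]
    have : ∀ μ : {μ : YoungDiagram // μ.cells.card = n},
        tableauSum n μ.1 (fun S => fqsymCoeff n ↑S m) = schurCoeff μ.1 m :=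
      fun μ => tableauSum_fqsymCoeff μ.2 m
    simp only [this]
    exact_mod_cast Iff.rfl
  constructor
  · intro h m
    obtain ⟨β, y, hβ, hy⟩ := exists_eq_sum_unimodalSign hn fun S => (fqsymCoeff n ↑S m : ℚ)
    exact (hr m).mpr (sum_tableauSum_eq_of_linear
      (w := fun T S => (unimodalSign (β T) S : ℚ)) hy _ _ Des hDes
      fun T => (hl _ (hβ T).1 (hβ T).2).mp (h _ (hβ T).1 (hβ T).2))
  · intro h α hα hsum
    obtain ⟨y, hy⟩ := exists_eq_sum_fqsymCoeff n fun S => (unimodalSign α S : ℚ)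
    refine (hl α hα hsum).mpr ?_
    refine sum_tableauSum_eq_of_linear (v := fun S => (unimodalSign α S : ℚ))
      (w := fun (T : ↥((Icc 1 (n - 1)).powerset)) S =>
        (fqsymCoeff n ↑S (content (stepWord n T.1)) : ℚ)) hy _ _ Des hDes fun T => ?_
    exact (hr (content (stepWord n T.1))).mp (h _)
end

section
/- For every n ≥ 1 and every σ ∈ Σ^B(n), the number of derangements w in B_n (signed permutations without fixed points as permutations of {±1,...,±n}) with sDes(w) = σ equals the number of w ∈ B_n in E^B_n with sDes(w⁻¹) = σ, where E^B_n is the set of w ∈ B_n for which the maximal k with w(1) >_r w(2) >_r ⋯ >_r w(k), all unbarred, is even (possibly zero). -/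
open Finset

/-- An element of the hyperoctahedral group `B_n` is modeled as a permutation `w` of
`Fin n × Bool` (the pair `(i, b)` representing the letter `i+1`, barred iff `b = true`)
commuting with the bar involution. -/
def IsSignedPerm {n : ℕ} (w : Equiv.Perm (Fin n × Bool)) : Prop :=
  ∀ p : Fin n × Bool, w (p.1, !p.2) = ((w p).1, !(w p).2)

/-- The letter `w(p+1)` of the signed permutation `w`, written in one-line notation, as a
pair (absolute value minus 1, barred?); junk value for `p ≥ n`. -/
def oneLine {n : ℕ} (w : Equiv.Perm (Fin n × Bool)) (p : ℕ) : ℕ × Bool :=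
  if h : p < n then (((w (⟨p, h⟩, false)).1 : ℕ), (w (⟨p, h⟩, false)).2) else (0, false)

/-- The rank of a letter in the total order `1̄ <_r ⋯ <_r n̄ <_r 1 <_r ⋯ <_r n`. -/
def rOrd (n : ℕ) (v : ℕ × Bool) : ℕ :=
  if v.2 then v.1 else n + v.1

/-- The signed (colored) descent set `sDes(w)` of a signed permutation, encoded as a word
`ℕ → Option Bool`: position `p` (0-based, representing `s = p+1`) carries `some b` iff
`s ∈ S`, where `S` consists of `n` together with all `s ∈ [n−1]` such that either
`w(s) >_r w(s+1)` or `w(s)` is barred and `w(s+1)` is unbarred, and `b = true` iff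
`w(s)` is barred. -/
def sDesPerm {n : ℕ} (w : Equiv.Perm (Fin n × Bool)) : ℕ → Option Bool := fun p =>
  if p + 1 = n then some (oneLine w p).2
  else if p + 1 < n ∧ (rOrd n (oneLine w (p + 1)) < rOrd n (oneLine w p) ∨
      ((oneLine w p).2 = true ∧ (oneLine w (p + 1)).2 = false))
    then some (oneLine w p).2 else none

/-- The chain property `P(k)`: the first `k` letters of `w` are all unbarred and strictly
decreasing with respect to `<_r`, i.e. `w(1) >_r w(2) >_r ⋯ >_r w(k) > 0`. -/
def DecreasingUnbarred {n : ℕ} (w : Equiv.Perm (Fin n × Bool)) (k : ℕ) : Prop :=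
  k ≤ n ∧ (∀ p < k, (oneLine w p).2 = false) ∧
    (∀ p : ℕ, p + 1 < k → rOrd n (oneLine w (p + 1)) < rOrd n (oneLine w p))

/-- `w` belongs to `E^B_n`: the maximal `k` with `w(1) >_r ⋯ >_r w(k)`, all unbarred,
is even (possibly zero). -/
def InEB {n : ℕ} (w : Equiv.Perm (Fin n × Bool)) : Prop :=
  ∃ k : ℕ, DecreasingUnbarred w k ∧ ¬ DecreasingUnbarred w (k + 1) ∧ Even k

/-- The permutation sending `x` to `y` and `x.succAbove j` to `y.succAbove (π j)`. -/
def insertPerm {n : ℕ} (x y : Fin (n + 1)) (π : Equiv.Perm (Fin n)) :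
    Equiv.Perm (Fin (n + 1)) :=
  (finSuccEquiv' x).trans ((Equiv.optionCongr π).trans (finSuccEquiv' y).symm)

section InsertPerm

variable {n : ℕ} (x y : Fin (n + 1)) (π : Equiv.Perm (Fin n))

@[simp] lemma insertPerm_self : insertPerm x y π x = y := by
  simp [insertPerm]

@[simp] lemma insertPerm_succAbove (j : Fin n) :
    insertPerm x y π (x.succAbove j) = y.succAbove (π j) := by
  simp [insertPerm]

lemma insertPerm_symm : (insertPerm x y π).symm = insertPerm y x π.symm := by
  ext a
  simp [insertPerm]

lemma insertPerm_injective : Function.Injective (insertPerm x y) := by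
  intro π τ h
  refine Equiv.ext fun j => ?_
  have := congrArg (fun e : Equiv.Perm (Fin (n + 1)) => e (x.succAbove j)) h
  simpa using this

lemma exists_insertPerm {τ : Equiv.Perm (Fin (n + 1))} (h : τ x = y) :
    ∃ π, insertPerm x y π = τ := by
  have h1 : ∀ j, ∃ k, y.succAbove k = τ (x.succAbove j) := fun j =>
    Fin.exists_succAbove_eq (fun e => Fin.succAbove_ne x j (τ.injective (e.trans h.symm)))
  choose k hk using h1
  have hinj : Function.Injective k := fun a b hab =>
    Fin.succAbove_right_injective (p := x) (τ.injective (by rw [← hk, ← hk, hab]))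
  refine ⟨Equiv.ofBijective k (Finite.injective_iff_bijective.1 hinj), ?_⟩
  ext a
  rcases Fin.eq_self_or_eq_succAbove x a with rfl | ⟨j, rfl⟩
  · simp [h]
  · simp [hk]

end InsertPerm

/-- `π` is increasing on each fibre of the labelling `f`. -/
def IncrOnFibers {n : ℕ} (f : Fin n → ℕ) (π : Equiv.Perm (Fin n)) : Prop :=
  ∀ a b, a < b → f a = f b → π a < π b

/-- Permutations increasing on the fibres of `f` with no fixed point labelled in `Q`. -/
def fixedPointFree {n : ℕ} (f : Fin n → ℕ) (Q : Finset ℕ) : Set (Equiv.Perm (Fin n)) :=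
  {π | IncrOnFibers f π ∧ ∀ a, f a ∈ Q → π a ≠ a}

/-- The first `k` values of `ρ` are decreasing and have labels in `Q`. -/
def DecrPrefix {n : ℕ} (f : Fin n → ℕ) (Q : Finset ℕ) (ρ : Equiv.Perm (Fin n)) (k : ℕ) :
    Prop :=
  k ≤ n ∧ (∀ p : Fin n, p.val < k → f (ρ p) ∈ Q) ∧
    ∀ p q : Fin n, p < q → q.val < k → ρ q < ρ p

/-- The longest decreasing prefix of `ρ` with labels in `Q` has even length. -/
def EvenPrefix {n : ℕ} (f : Fin n → ℕ) (Q : Finset ℕ) (ρ : Equiv.Perm (Fin n)) : Prop :=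
  ∃ k, DecrPrefix f Q ρ k ∧ ¬ DecrPrefix f Q ρ (k + 1) ∧ Even k

/-- Permutations increasing on the fibres of `f` whose inverse has an even prefix. -/
def evenPrefixed {n : ℕ} (f : Fin n → ℕ) (Q : Finset ℕ) : Set (Equiv.Perm (Fin n)) :=
  {π | IncrOnFibers f π ∧ EvenPrefix f Q π.symm}

section Prefix

variable {n : ℕ} {f : Fin n → ℕ} {Q : Finset ℕ} {ρ : Equiv.Perm (Fin n)}

lemma decrPrefix_zero : DecrPrefix f Q ρ 0 := by
  simp [DecrPrefix]

lemma DecrPrefix.mono {j k : ℕ} (h : DecrPrefix f Q ρ k) (hjk : j ≤ k) :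
    DecrPrefix f Q ρ j :=
  ⟨hjk.trans h.1, fun p hp => h.2.1 p (hp.trans_le hjk),
    fun p q hpq hq => h.2.2 p q hpq (hq.trans_le hjk)⟩

lemma exists_maximal_decrPrefix :
    ∃ k, DecrPrefix f Q ρ k ∧ ¬ DecrPrefix f Q ρ (k + 1) := by
  by_contra! h
  have : ∀ k, DecrPrefix f Q ρ k := fun k => by
    induction k with
    | zero => exact decrPrefix_zero
    | succ k ih => exact h k ih
  exact absurd (this (n + 1)).1 (by omega)

lemma maximal_decrPrefix_unique {j k : ℕ} (hj : DecrPrefix f Q ρ j)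
    (hj' : ¬ DecrPrefix f Q ρ (j + 1)) (hk : DecrPrefix f Q ρ k)
    (hk' : ¬ DecrPrefix f Q ρ (k + 1)) : j = k := by
  rcases lt_trichotomy j k with h | h | h
  · exact absurd (hk.mono h) hj'
  · exact h
  · exact absurd (hj.mono h) hk'

lemma not_evenPrefix_iff :
    ¬ EvenPrefix f Q ρ ↔ ∃ k, DecrPrefix f Q ρ k ∧ ¬ DecrPrefix f Q ρ (k + 1) ∧ ¬ Even k := by
  constructor
  · intro h
    obtain ⟨k, hk, hk'⟩ := exists_maximal_decrPrefix (f := f) (Q := Q) (ρ := ρ)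
    exact ⟨k, hk, hk', fun he => h ⟨k, hk, hk', he⟩⟩
  · rintro ⟨k, hk, hk', ho⟩ ⟨j, hj, hj', he⟩
    exact ho (maximal_decrPrefix_unique hj hj' hk hk' ▸ he)

lemma evenPrefix_of_not_one (h : ¬ DecrPrefix f Q ρ 1) : EvenPrefix f Q ρ :=
  ⟨0, decrPrefix_zero, h, by simp⟩

lemma evenPrefix_congr {Q' : Finset ℕ} (h : ∀ k, DecrPrefix f Q ρ k ↔ DecrPrefix f Q' ρ k) :
    EvenPrefix f Q ρ ↔ EvenPrefix f Q' ρ := by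
  simp only [EvenPrefix, h]

end Prefix

section Step

variable {n : ℕ} {f : Fin (n + 1) → ℕ} {Q : Finset ℕ}

/-- Deleting any element of a fibre of a monotone labelling gives the same labelling. -/
lemma comp_succAbove_eq (hf : Monotone f) {x y : Fin (n + 1)} (h : f x = f y) (j : Fin n) :
    f (x.succAbove j) = f (y.succAbove j) := by
  wlog hxy : x ≤ y generalizing x y
  · exact (this h.symm (le_of_not_ge hxy)).symm
  rcases lt_or_ge j.castSucc x with h1 | h1
  · rw [Fin.succAbove_of_castSucc_lt _ _ h1, Fin.succAbove_of_castSucc_lt _ _ (h1.trans_le hxy)]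
  · rw [Fin.succAbove_of_le_castSucc _ _ h1]
    rcases lt_or_ge j.castSucc y with h2 | h2
    · rw [Fin.succAbove_of_castSucc_lt _ _ h2]
      have a1 : f x ≤ f j.castSucc := hf h1
      have a2 : f j.succ ≤ f y := hf (Fin.le_def.2 (Fin.lt_def.1 h2))
      have a3 : f j.castSucc ≤ f j.succ := hf j.castSucc_lt_succ.le
      omega
    · rw [Fin.succAbove_of_le_castSucc _ _ h2]

lemma monotone_comp_succAbove (hf : Monotone f) (x : Fin (n + 1)) :
    Monotone (f ∘ x.succAbove) :=
  hf.comp (Fin.strictMono_succAbove x).monotone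

lemma IncrOnFibers.of_insertPerm {x y : Fin (n + 1)} {π : Equiv.Perm (Fin n)}
    (h : IncrOnFibers f (insertPerm x y π)) : IncrOnFibers (f ∘ x.succAbove) π := by
  intro a b hab hf
  have := h _ _ (Fin.succAbove_lt_succAbove_iff (p := x) |>.2 hab) hf
  simpa [Fin.succAbove_lt_succAbove_iff] using this

lemma incrOnFibers_insertPerm_iff {x y : Fin (n + 1)} {π : Equiv.Perm (Fin n)} :
    IncrOnFibers f (insertPerm x y π) ↔ IncrOnFibers (f ∘ x.succAbove) π ∧
      ∀ j, f (x.succAbove j) = f x →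
        (x.succAbove j < x → y.succAbove (π j) < y) ∧
        (x < x.succAbove j → y < y.succAbove (π j)) := by
  constructor
  · intro h
    refine ⟨h.of_insertPerm, fun j hj => ⟨fun hlt => ?_, fun hlt => ?_⟩⟩
    · simpa using h _ _ hlt hj
    · simpa using h _ _ hlt hj.symm
  · rintro ⟨h, h'⟩ a b hab hfab
    rcases Fin.eq_self_or_eq_succAbove x a with rfl | ⟨i, rfl⟩
    · rcases Fin.eq_self_or_eq_succAbove a b with rfl | ⟨j, rfl⟩
      · exact absurd hab (lt_irrefl _)
      · simpa using (h' j hfab.symm).2 hab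
    · rcases Fin.eq_self_or_eq_succAbove x b with rfl | ⟨j, rfl⟩
      · simpa using (h' i hfab).1 hab
      · simpa [Fin.succAbove_lt_succAbove_iff] using
          h i j (Fin.succAbove_lt_succAbove_iff.1 hab) hfab

/-- Prefixing the inverse by the first element of a fibre preserves increase on fibres. -/
lemma incrOnFibers_insertPerm_zero_iff {l : Fin (n + 1)} (hl : ∀ x, f x = f l → l ≤ x)
    {π : Equiv.Perm (Fin n)} :
    IncrOnFibers f (insertPerm l 0 π) ↔ IncrOnFibers (f ∘ l.succAbove) π := by
  rw [incrOnFibers_insertPerm_iff, and_iff_left_iff_imp]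
  intro _ j hj
  refine ⟨fun h => absurd (hl _ hj) (not_le.2 h), fun _ => ?_⟩
  simp

lemma decrPrefix_insertPerm_succ (hf : Monotone f) {l : Fin (n + 1)}
    (hl : ∀ x, f x = f l → l ≤ x) (hQ : ∀ q ∈ Q, q < f l) (ρ : Equiv.Perm (Fin n)) (k : ℕ) :
    DecrPrefix f (insert (f l) Q) (insertPerm 0 l ρ) (k + 1) ↔
      DecrPrefix (f ∘ l.succAbove) Q ρ k := by
  have hs : ∀ j : Fin n, insertPerm 0 l ρ j.succ = l.succAbove (ρ j) := fun j => by
    simpa using insertPerm_succAbove 0 l ρ j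
  constructor
  · rintro ⟨h1, h2, h3⟩
    refine ⟨by omega, fun p hp => ?_, fun p q hpq hq => ?_⟩
    · have := h2 p.succ (by simpa using hp)
      have hlt := h3 0 p.succ (by simp) (by simpa using hp)
      rw [hs] at this hlt
      rw [insertPerm_self] at hlt
      exact (Finset.mem_insert.1 this).resolve_left (fun e => absurd (hl _ e) (not_le.2 hlt))
    · have := h3 p.succ q.succ (by simpa using hpq) (by simpa using hq)
      rw [hs, hs] at this
      exact Fin.succAbove_lt_succAbove_iff.1 this
  · rintro ⟨h1, h2, h3⟩
    refine ⟨by omega, fun p hp => ?_, fun p q hpq hq => ?_⟩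
    · cases p using Fin.cases with
      | zero => simp
      | succ p => rw [hs]; exact Finset.mem_insert_of_mem (h2 p (by simpa using hp))
    · cases q using Fin.cases with
      | zero => simp at hpq
      | succ q =>
        cases p using Fin.cases with
        | zero =>
          rw [hs, insertPerm_self]
          have := hQ _ (h2 q (by simpa using hq))
          exact hf.reflect_lt this
        | succ p =>
          rw [hs, hs]
          exact Fin.succAbove_lt_succAbove_iff.2 (h3 p q (by simpa using hpq) (by simpa using hq))

lemma evenPrefix_insertPerm_iff (hf : Monotone f) {l : Fin (n + 1)}
    (hl : ∀ x, f x = f l → l ≤ x) (hQ : ∀ q ∈ Q, q < f l) (ρ : Equiv.Perm (Fin n)) :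
    EvenPrefix f (insert (f l) Q) (insertPerm 0 l ρ) ↔
      ¬ EvenPrefix (f ∘ l.succAbove) Q ρ := by
  rw [not_evenPrefix_iff]
  constructor
  · rintro ⟨k, h1, h2, h3⟩
    cases k with
    | zero =>
      rw [decrPrefix_insertPerm_succ hf hl hQ] at h2
      exact absurd decrPrefix_zero h2
    | succ k =>
      rw [decrPrefix_insertPerm_succ hf hl hQ] at h1 h2
      exact ⟨k, h1, h2, Nat.even_add_one.1 h3⟩
  · rintro ⟨k, h1, h2, h3⟩
    rw [← decrPrefix_insertPerm_succ hf hl hQ] at h1 h2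
    exact ⟨k + 1, h1, h2, Nat.even_add_one.2 h3⟩

end Step

lemma decrPrefix_insert_iff {n : ℕ} {f : Fin n → ℕ} {Q : Finset ℕ} {ρ : Equiv.Perm (Fin n)}
    {i : ℕ} (hf : Monotone f) (hQ : ∀ q ∈ Q, q < i)
    (h : ∀ p : Fin n, p.val = 0 → f (ρ p) ≠ i) (k : ℕ) :
    DecrPrefix f (insert i Q) ρ k ↔ DecrPrefix f Q ρ k := by
  constructor
  · rintro ⟨h1, h2, h3⟩
    refine ⟨h1, fun p hp => ?_, h3⟩
    refine (Finset.mem_insert.1 (h2 p hp)).resolve_left (fun e => ?_)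
    by_cases hp0 : p.val = 0
    · exact h p hp0 e
    · let z : Fin n := ⟨0, by omega⟩
      have hz := (Finset.mem_insert.1 (h2 z (by simp [z]; omega))).resolve_left (h z rfl)
      have := hf (h3 z p (Fin.lt_def.2 (by simp [z]; omega)) hp).le
      have := hQ _ hz
      omega
  · rintro ⟨h1, h2, h3⟩
    exact ⟨h1, fun p hp => Finset.mem_insert_of_mem (h2 p hp), h3⟩

lemma ncard_evenPrefixed_insert {n : ℕ} {f : Fin (n + 1) → ℕ} {Q : Finset ℕ} (hf : Monotone f)
    {l : Fin (n + 1)} (hl : ∀ x, f x = f l → l ≤ x) (hQ : ∀ q ∈ Q, q < f l) :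
    (evenPrefixed f (insert (f l) Q)).ncard + (evenPrefixed (f ∘ l.succAbove) Q).ncard =
      (evenPrefixed f Q).ncard := by
  set H : Set (Equiv.Perm (Fin (n + 1))) := {π | π l = 0} with hH
  set G : Set (Equiv.Perm (Fin n)) := {π | IncrOnFibers (f ∘ l.succAbove) π} with hG
  have hinj := insertPerm_injective l (0 : Fin (n + 1))
  have key : evenPrefixed f (insert (f l) Q) \ H = evenPrefixed f Q \ H := by
    ext π
    simp only [evenPrefixed, Set.mem_sdiff, Set.mem_ofPred_eq, hH]
    refine and_congr_left fun h0 => and_congr_right fun hi => evenPrefix_congr ?_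
    refine decrPrefix_insert_iff hf hQ fun p hp e => ?_
    obtain rfl : p = 0 := Fin.ext hp
    rcases (hl _ e).eq_or_lt with h | h
    · exact h0 (by rw [h]; simp)
    · have := hi _ _ h e.symm
      simp at this
  have k1 : evenPrefixed f Q ∩ H = insertPerm l 0 '' G := by
    ext π
    simp only [evenPrefixed, Set.mem_inter_iff, Set.mem_ofPred_eq, hH, hG, Set.mem_image]
    constructor
    · rintro ⟨⟨h1, -⟩, h2⟩
      obtain ⟨π, rfl⟩ := exists_insertPerm l 0 h2
      exact ⟨π, h1.of_insertPerm, rfl⟩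
    · rintro ⟨π, h, rfl⟩
      refine ⟨⟨(incrOnFibers_insertPerm_zero_iff hl).2 h, evenPrefix_of_not_one ?_⟩, by simp⟩
      rintro ⟨-, h2, -⟩
      have := hQ _ (h2 0 (by simp))
      simp [insertPerm_symm] at this
  have k2 : evenPrefixed f (insert (f l) Q) ∩ H =
      insertPerm l 0 '' (G \ evenPrefixed (f ∘ l.succAbove) Q) := by
    ext π
    simp only [evenPrefixed, Set.mem_inter_iff, Set.mem_ofPred_eq, hH, hG, Set.mem_image,
      Set.mem_sdiff]
    constructor
    · rintro ⟨⟨h1, h3⟩, h2⟩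
      obtain ⟨π, rfl⟩ := exists_insertPerm l 0 h2
      rw [insertPerm_symm, evenPrefix_insertPerm_iff hf hl hQ] at h3
      exact ⟨π, ⟨h1.of_insertPerm, fun h => h3 h.2⟩, rfl⟩
    · rintro ⟨π, ⟨h, h'⟩, rfl⟩
      refine ⟨⟨(incrOnFibers_insertPerm_zero_iff hl).2 h, ?_⟩, by simp⟩
      rw [insertPerm_symm, evenPrefix_insertPerm_iff hf hl hQ]
      exact fun h2 => h' ⟨h, h2⟩
  have e1 := Set.ncard_inter_add_ncard_sdiff_eq_ncard (evenPrefixed f Q) H (Set.toFinite _)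
  have e2 := Set.ncard_inter_add_ncard_sdiff_eq_ncard (evenPrefixed f (insert (f l) Q)) H
    (Set.toFinite _)
  have e3 := Set.ncard_sdiff_add_ncard_of_subset
    (show evenPrefixed (f ∘ l.succAbove) Q ⊆ G from fun _ h => h.1) (Set.toFinite _)
  rw [k1, Set.ncard_image_of_injective _ hinj] at e1
  rw [k2, key, Set.ncard_image_of_injective _ hinj] at e2
  omega

/-- On a fibre of a monotone labelling, `π x - x` is weakly increasing. -/
lemma IncrOnFibers.add_le {n : ℕ} {f : Fin n → ℕ} {π : Equiv.Perm (Fin n)} (hf : Monotone f)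
    (h : IncrOnFibers f π) (d : ℕ) (x y : Fin n) (hd : y.val = x.val + d) (hxy : f x = f y) :
    (π x).val + d ≤ (π y).val := by
  induction d generalizing y with
  | zero => obtain rfl : y = x := Fin.ext hd; simp
  | succ d ih =>
    let z : Fin n := ⟨x.val + d, by omega⟩
    have hzy : z < y := Fin.lt_def.2 (by simp [z]; omega)
    have hxz : x ≤ z := Fin.le_def.2 (by simp [z])
    have e : f x = f z := le_antisymm (hf hxz) (hxy ▸ hf hzy.le)
    have h1 := ih z rfl e
    have h2 := Fin.lt_def.1 (h z y hzy (e.symm.trans hxy))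
    omega

section FixedStep

variable {n : ℕ} {f : Fin (n + 1) → ℕ} {Q : Finset ℕ}

/-- `x` is the place where a last fixed point of the fibre of `x` can be inserted in `π`. -/
def IsInsertionPlace (f : Fin (n + 1) → ℕ) (x : Fin (n + 1)) (π : Equiv.Perm (Fin n)) : Prop :=
  ∀ j : Fin n, f (x.succAbove j) = f x →
    (j.castSucc < x → (π j).castSucc < x) ∧ (x ≤ j.castSucc → j < π j)

lemma incrOnFibers_insertPerm_and_last_iff (hf : Monotone f) (x : Fin (n + 1))
    (π : Equiv.Perm (Fin n)) :
    (IncrOnFibers f (insertPerm x x π) ∧ ∀ y, f y = f x → x < y → insertPerm x x π y ≠ y) ↔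
      IncrOnFibers (f ∘ x.succAbove) π ∧ IsInsertionPlace f x π := by
  constructor
  · rintro ⟨h1, h2⟩
    refine ⟨h1.of_insertPerm, fun j hj => ⟨fun hlt => ?_, fun hle => ?_⟩⟩
    · have := ((incrOnFibers_insertPerm_iff.1 h1).2 j hj).1
      rw [Fin.succAbove_lt_iff_castSucc_lt, Fin.succAbove_lt_iff_castSucc_lt] at this
      exact this hlt
    · have hlt := Fin.lt_succAbove_iff_le_castSucc x j |>.2 hle
      have h3 := h1.add_le hf ((x.succAbove j).val - x.val) x (x.succAbove j)
        (by have := Fin.lt_def.1 hlt; omega) hj.symm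
      have h4 := h2 _ hj hlt
      rw [insertPerm_self, insertPerm_succAbove] at h3
      rw [insertPerm_succAbove] at h4
      refine lt_of_le_of_ne ?_ (fun e => h4 (by rw [← e]))
      rw [← Fin.succAbove_le_succAbove_iff (p := x), Fin.le_def]
      omega
  · rintro ⟨h1, h2⟩
    refine ⟨incrOnFibers_insertPerm_iff.2 ⟨h1, fun j hj => ?_⟩, fun y hy hlt => ?_⟩
    · rw [Fin.succAbove_lt_iff_castSucc_lt, Fin.succAbove_lt_iff_castSucc_lt,
        Fin.lt_succAbove_iff_le_castSucc, Fin.lt_succAbove_iff_le_castSucc]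
      refine ⟨(h2 j hj).1, fun hle => hle.trans ?_⟩
      exact (Fin.castSucc_lt_castSucc_iff.2 ((h2 j hj).2 hle)).le
    · obtain ⟨j, rfl⟩ := Fin.exists_succAbove_eq hlt.ne'
      rw [insertPerm_succAbove]
      intro e
      have := (h2 j hy).2 ((Fin.lt_succAbove_iff_le_castSucc x j).1 hlt)
      rw [Fin.succAbove_right_injective e] at this
      exact lt_irrefl _ this

lemma IsInsertionPlace.unique (hf : Monotone f) {x y : Fin (n + 1)} {π : Equiv.Perm (Fin n)}
    (hxy : f x = f y) (hx : IsInsertionPlace f x π) (hy : IsInsertionPlace f y π) : x = y := by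
  wlog hlt : x < y generalizing x y
  · rcases (not_lt.1 hlt).eq_or_lt with h | h
    · exact h.symm
    · exact (this hxy.symm hy hx h).symm
  exfalso
  obtain ⟨j, rfl⟩ := Fin.exists_succ_eq.2 (Fin.ne_zero_of_lt hlt)
  have hle : x ≤ j.castSucc := Fin.le_def.2 (by have := Fin.lt_def.1 hlt; simp at this ⊢; omega)
  have e : f (x.succAbove j) = f x := by rw [Fin.succAbove_of_le_castSucc _ _ hle, hxy]
  have h1 := (hx j e).2 hle
  have h2 := (hy j ((comp_succAbove_eq hf hxy j).symm.trans (e.trans hxy))).1 j.castSucc_lt_succ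
  rw [Fin.lt_def] at h1 h2
  simp at h2
  omega

lemma exists_isInsertionPlace (hf : Monotone f) (l : Fin (n + 1)) {π : Equiv.Perm (Fin n)}
    (h : IncrOnFibers (f ∘ l.succAbove) π) : ∃ x, f x = f l ∧ IsInsertionPlace f x π := by
  classical
  let S : Finset (Fin (n + 1)) := Finset.univ.filter fun x =>
    f x = f l ∧ ∀ j : Fin n, f (l.succAbove j) = f l → x ≤ j.castSucc → j < π j
  have hS : S.Nonempty := by
    let F : Finset (Fin (n + 1)) := Finset.univ.filter fun x => f x = f l
    have hF : F.Nonempty := ⟨l, by simp [F]⟩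
    have hr : f (F.max' hF) = f l := by simpa [F] using F.max'_mem hF
    refine ⟨F.max' hF, ?_⟩
    simp only [S, Finset.mem_filter, Finset.mem_univ, true_and]
    refine ⟨hr, fun j hj hle => ?_⟩
    rw [← comp_succAbove_eq hf hr, Fin.succAbove_of_le_castSucc _ _ hle] at hj
    have := F.le_max' j.succ (by simp [F, hj])
    exact absurd (this.trans hle) (not_le.2 j.castSucc_lt_succ)
  obtain ⟨hx1, hx2⟩ : f (S.min' hS) = f l ∧ ∀ j : Fin n, f (l.succAbove j) = f l →
      S.min' hS ≤ j.castSucc → j < π j := by simpa [S] using S.min'_mem hS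
  refine ⟨S.min' hS, hx1, fun j hj => ?_⟩
  have hj' : f (l.succAbove j) = f l := by rw [← comp_succAbove_eq hf hx1, hj, hx1]
  refine ⟨fun hlt => ?_, hx2 j hj'⟩
  by_contra hge
  have hmem : j.castSucc ∈ S := by
    simp only [S, Finset.mem_filter, Finset.mem_univ, true_and]
    rw [Fin.succAbove_of_castSucc_lt _ _ hlt] at hj
    refine ⟨hj.trans hx1, fun k hk hle => ?_⟩
    have hle' : j.val ≤ k.val := by simpa using hle
    have := h.add_le (monotone_comp_succAbove hf l) (k.val - j.val) j k (by omega)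
      (hj'.trans hk.symm)
    have h2 := Fin.lt_def.1 hlt
    have h3 := Fin.le_def.1 (not_lt.1 hge)
    simp only [Fin.val_castSucc] at h2 h3
    exact Fin.lt_def.2 (by omega)
  exact absurd (S.min'_le _ hmem) (not_le.2 hlt)

lemma ncard_fixedPointFree_insert (hf : Monotone f) (l : Fin (n + 1)) (hQ : f l ∉ Q) :
    (fixedPointFree f (insert (f l) Q)).ncard + (fixedPointFree (f ∘ l.succAbove) Q).ncard =
      (fixedPointFree f Q).ncard := by
  have hsub : fixedPointFree f (insert (f l) Q) ⊆ fixedPointFree f Q :=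
    fun π h => ⟨h.1, fun a ha => h.2 a (Finset.mem_insert_of_mem ha)⟩
  have hcomp : ∀ x, f x = f l → f ∘ x.succAbove = f ∘ l.succAbove := fun x hx =>
    funext fun j => comp_succAbove_eq hf hx j
  have hfree : ∀ x (π : Equiv.Perm (Fin n)), f x = f l →
      ((∀ a, f a ∈ Q → insertPerm x x π a ≠ a) ↔
        ∀ j, (f ∘ l.succAbove) j ∈ Q → π j ≠ j) := by
    intro x π hx
    rw [← hcomp x hx]
    constructor
    · intro h j hj e
      exact h _ hj (by rw [insertPerm_succAbove, e])
    · intro h a ha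
      rcases Fin.eq_self_or_eq_succAbove x a with rfl | ⟨j, rfl⟩
      · exact absurd (hx ▸ ha) hQ
      · rw [insertPerm_succAbove]
        exact fun e => h j ha (Fin.succAbove_right_injective e)
  choose! x hx1 hx2 using fun (π : Equiv.Perm (Fin n))
    (h : IncrOnFibers (f ∘ l.succAbove) π) => exists_isInsertionPlace hf l h
  have hlast : ∀ π, IncrOnFibers (f ∘ l.succAbove) π →
      IncrOnFibers f (insertPerm (x π) (x π) π) ∧
        ∀ y, f y = f (x π) → x π < y → insertPerm (x π) (x π) π y ≠ y := fun π h =>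
    (incrOnFibers_insertPerm_and_last_iff hf (x π) π).2
      ⟨(hcomp _ (hx1 π h)).symm ▸ h, hx2 π h⟩
  have hcard : (fixedPointFree (f ∘ l.succAbove) Q).ncard =
      (fixedPointFree f Q \ fixedPointFree f (insert (f l) Q)).ncard := by
    refine Set.ncard_congr (fun π _ => insertPerm (x π) (x π) π) ?_ ?_ ?_
    · rintro π ⟨h1, h2⟩
      refine ⟨⟨(hlast π h1).1, (hfree _ _ (hx1 π h1)).2 h2⟩, fun h => ?_⟩
      exact h.2 (x π) (by simp [hx1 π h1]) (insertPerm_self _ _ _)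
    · rintro π τ ⟨h1, -⟩ ⟨h2, -⟩ (e : insertPerm _ _ _ = insertPerm _ _ _)
      have hxx : f (x π) = f (x τ) := (hx1 π h1).trans (hx1 τ h2).symm
      have : x π = x τ := by
        rcases lt_trichotomy (x π) (x τ) with h | h | h
        · exact absurd (e ▸ insertPerm_self (x τ) (x τ) τ) ((hlast π h1).2 _ hxx.symm h)
        · exact h
        · exact absurd (e ▸ insertPerm_self (x π) (x π) π) ((hlast τ h2).2 _ hxx h)
      rw [this] at e
      exact insertPerm_injective _ _ e
    · rintro τ ⟨⟨h1, h2⟩, h3⟩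
      classical
      let F : Finset (Fin (n + 1)) := Finset.univ.filter fun y => f y = f l ∧ τ y = y
      have hF : F.Nonempty := by
        by_contra hne
        refine h3 ⟨h1, fun a ha e => ?_⟩
        rcases Finset.mem_insert.1 ha with ha | ha
        · exact hne ⟨a, by simp [F, ha, e]⟩
        · exact h2 a ha e
      obtain ⟨hy1, hy2⟩ : f (F.max' hF) = f l ∧ τ (F.max' hF) = F.max' hF := by
        simpa [F] using F.max'_mem hF
      have hy3 : ∀ z, f z = f (F.max' hF) → F.max' hF < z → τ z ≠ z := fun z hz hlt e =>
        absurd (F.le_max' z (by simp [F, e, hz, hy1])) (not_le.2 hlt)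
      generalize F.max' hF = y at hy1 hy2 hy3
      obtain ⟨π, rfl⟩ := exists_insertPerm y y hy2
      obtain ⟨h4, h5⟩ := (incrOnFibers_insertPerm_and_last_iff hf y π).1 ⟨h1, hy3⟩
      rw [hcomp y hy1] at h4
      have hxy : x π = y :=
        IsInsertionPlace.unique hf ((hx1 π h4).trans hy1.symm) (hx2 π h4) h5
      exact ⟨π, ⟨h4, (hfree y π hy1).1 h2⟩, by simp only [hxy]⟩
  have := Set.ncard_sdiff_add_ncard_of_subset hsub (Set.toFinite _)
  omega

end FixedStep

theorem ncard_fixedPointFree_eq_ncard_evenPrefixed {n : ℕ} {f : Fin n → ℕ} (hf : Monotone f)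
    (Q : Finset ℕ) : (fixedPointFree f Q).ncard = (evenPrefixed f Q).ncard := by
  induction Q using Finset.induction_on_max generalizing n with
  | empty =>
    congr 1
    ext π
    simp only [fixedPointFree, evenPrefixed, Set.mem_ofPred_eq]
    refine and_congr_right fun _ => ⟨fun _ => evenPrefix_of_not_one ?_, fun _ => by simp⟩
    rintro ⟨h1, h2, -⟩
    simpa using h2 ⟨0, h1⟩ (by simp)
  | insert i Q hQ ih =>
    by_cases hi : ∃ x, f x = i
    · obtain ⟨m, rfl⟩ : ∃ m, n = m + 1 := by
        obtain ⟨x, -⟩ := hi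
        exact ⟨n - 1, by have := x.isLt; omega⟩
      classical
      let F : Finset (Fin (m + 1)) := Finset.univ.filter fun y => f y = i
      have hF : F.Nonempty := hi.imp fun x hx => by simp [F, hx]
      have hl : f (F.min' hF) = i := by simpa [F] using F.min'_mem hF
      have hl' : ∀ x, f x = f (F.min' hF) → F.min' hF ≤ x := fun x hx =>
        F.min'_le _ (by simp [F, hx, hl])
      generalize F.min' hF = l at hl hl'
      subst hl
      have h1 := ncard_fixedPointFree_insert hf l (fun h => lt_irrefl _ (hQ _ h))
      have h2 := ncard_evenPrefixed_insert hf hl' hQ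
      have h3 := ih hf
      have h4 := ih (monotone_comp_succAbove hf l)
      omega
    · push Not at hi
      have h1 : fixedPointFree f (insert i Q) = fixedPointFree f Q := by
        ext π
        simp [fixedPointFree, hi]
      have h2 : evenPrefixed f (insert i Q) = evenPrefixed f Q := by
        ext π
        simp only [evenPrefixed, Set.mem_ofPred_eq]
        exact and_congr_right fun _ =>
          evenPrefix_congr (decrPrefix_insert_iff hf hQ fun p _ => hi _)
      rw [h1, h2, ih hf]

/-- The least position `q ≥ p` at which the word `σ` is marked. -/
noncomputable def blockEnd (σ : ℕ → Option Bool) (p : ℕ) : ℕ :=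
  sInf {q | p ≤ q ∧ σ q ≠ none}

/-- `σ` encodes a signed subset of `[n]` containing `n`. -/
def IsSignedSet (n : ℕ) (σ : ℕ → Option Bool) : Prop :=
  σ (n - 1) ≠ none ∧ ∀ p, n ≤ p → σ p = none

section BlockEnd

variable {n : ℕ} {σ : ℕ → Option Bool}

lemma IsSignedSet.succ_lt (hσ : IsSignedSet n σ) {p : ℕ} (hp : p < n) (h : σ p = none) :
    p + 1 < n := by
  by_contra hlt
  obtain rfl : p = n - 1 := by omega
  exact hσ.1 h

lemma IsSignedSet.blockEnd_spec (hσ : IsSignedSet n σ) {p : ℕ} (hp : p < n) :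
    p ≤ blockEnd σ p ∧ σ (blockEnd σ p) ≠ none :=
  Nat.sInf_mem (s := {q | p ≤ q ∧ σ q ≠ none}) ⟨n - 1, by omega, hσ.1⟩

lemma IsSignedSet.blockEnd_lt (hσ : IsSignedSet n σ) {p : ℕ} (hp : p < n) :
    blockEnd σ p < n := by
  by_contra h
  exact (hσ.blockEnd_spec hp).2 (hσ.2 _ (not_lt.1 h))

lemma blockEnd_le {p q : ℕ} (hpq : p ≤ q) (h : σ q ≠ none) : blockEnd σ p ≤ q :=
  Nat.sInf_le ⟨hpq, h⟩

lemma IsSignedSet.blockEnd_mono (hσ : IsSignedSet n σ) :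
    Monotone fun p : Fin n => blockEnd σ p := fun _ q hpq =>
  blockEnd_le ((Fin.le_def.1 hpq).trans (hσ.blockEnd_spec q.isLt).1) (hσ.blockEnd_spec q.isLt).2

lemma IsSignedSet.blockEnd_of_ne_none (hσ : IsSignedSet n σ) {p : ℕ} (hp : p < n)
    (h : σ p ≠ none) : blockEnd σ p = p :=
  le_antisymm (blockEnd_le le_rfl h) (hσ.blockEnd_spec hp).1

lemma IsSignedSet.blockEnd_of_eq_none (hσ : IsSignedSet n σ) {p : ℕ} (hp : p < n)
    (h : σ p = none) : blockEnd σ p = blockEnd σ (p + 1) := by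
  have h1 := hσ.blockEnd_spec hp
  have h2 := hσ.blockEnd_spec (hσ.succ_lt hp h)
  refine le_antisymm (blockEnd_le (by omega) h2.2) (blockEnd_le ?_ h1.2)
  refine Nat.lt_of_le_of_ne h1.1 fun e => ?_
  rw [← e] at h1
  exact h1.2 h

/-- Increasing on the blocks of `σ` may be tested on consecutive positions. -/
lemma IsSignedSet.incrOnFibers_iff (hσ : IsSignedSet n σ) (π : Equiv.Perm (Fin n)) :
    IncrOnFibers (fun p : Fin n => blockEnd σ p) π ↔
      ∀ p q : Fin n, q.val = p.val + 1 → σ p = none → π p < π q := by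
  constructor
  · intro h p q hpq hp
    refine h p q (Fin.lt_def.2 (by omega)) ?_
    simp only [hpq, hσ.blockEnd_of_eq_none p.isLt hp]
  · intro h a b hab he
    obtain ⟨d, hd⟩ : ∃ d, b.val = a.val + d + 1 :=
      ⟨b.val - a.val - 1, by have := Fin.lt_def.1 hab; omega⟩
    induction d generalizing b with
    | zero =>
      refine h a b hd ?_
      by_contra hne
      have h1 := hσ.blockEnd_of_ne_none a.isLt hne
      have h2 := (hσ.blockEnd_spec b.isLt).1
      simp only at he
      omega
    | succ d ih =>
      let z : Fin n := ⟨a.val + d + 1, by omega⟩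
      have hz : σ z = none := by
        by_contra hne
        have h1 : blockEnd σ a ≤ z := blockEnd_le (by simp [z]; omega) hne
        have h2 := (hσ.blockEnd_spec b.isLt).1
        simp only [z] at h1
        simp only at he
        omega
      have hzb : b.val = z.val + 1 := by simp only [z]; omega
      refine (ih z (Fin.lt_def.2 (by simp only [z]; omega)) ?_ rfl).trans (h z b hzb hz)
      simp only at he ⊢
      rw [he, hσ.blockEnd_of_eq_none z.isLt hz, hzb]

end BlockEnd

/-- The colour of the block of `p` in `σ`. -/
noncomputable def blockColor (σ : ℕ → Option Bool) (p : ℕ) : Bool :=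
  decide (σ (blockEnd σ p) = some true)

/-- The labels of the unbarred blocks of `σ`. -/
def unbarredBlocks (n : ℕ) (σ : ℕ → Option Bool) : Finset ℕ :=
  (Finset.range n).filter fun q => σ q = some false

lemma IsSignedSet.blockEnd_mem_unbarredBlocks (n : ℕ) {σ : ℕ → Option Bool}
    (hσ : IsSignedSet n σ) (p : Fin n) :
    blockEnd σ p ∈ unbarredBlocks n σ ↔ blockColor σ p = false := by
  have h := (hσ.blockEnd_spec p.isLt).2
  simp only [unbarredBlocks, blockColor, Finset.mem_filter, Finset.mem_range,
    hσ.blockEnd_lt p.isLt, true_and, decide_eq_false_iff_not]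
  rcases hb : σ (blockEnd σ p) with _ | _ | _ <;> simp_all

section SignedPerm

variable {n : ℕ}

/-- The signed permutation with absolute values `π` and colours `c`. -/
def toSigned (c : Fin n → Bool) (π : Equiv.Perm (Fin n)) : Equiv.Perm (Fin n × Bool) where
  toFun q := (π q.1, xor q.2 (c q.1))
  invFun q := (π.symm q.1, xor q.2 (c (π.symm q.1)))
  left_inv q := by simp
  right_inv q := by simp

lemma isSignedPerm_toSigned (c : Fin n → Bool) (π : Equiv.Perm (Fin n)) :
    IsSignedPerm (toSigned c π) := by
  rintro ⟨a, b⟩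
  simp [toSigned]

lemma toSigned_injective (c : Fin n → Bool) : Function.Injective (toSigned c) := by
  intro π τ h
  refine Equiv.ext fun a => ?_
  have := congrArg (fun e : Equiv.Perm (Fin n × Bool) => (e (a, false)).1) h
  simpa [toSigned] using this

lemma exists_toSigned {w : Equiv.Perm (Fin n × Bool)} (hw : IsSignedPerm w)
    {c : Fin n → Bool} (hc : ∀ a, (w (a, false)).2 = c a) : ∃ π, toSigned c π = w := by
  have hsurj : Function.Surjective fun a => (w (a, false)).1 := fun y => by
    obtain ⟨⟨a, b⟩, h⟩ := w.surjective (y, false)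
    cases b with
    | false => exact ⟨a, by simp [h]⟩
    | true =>
      refine ⟨a, ?_⟩
      have := hw (a, true)
      simp only [Bool.not_true] at this
      simp [this, h]
  refine ⟨Equiv.ofBijective _ (Finite.surjective_iff_bijective.1 hsurj), ?_⟩
  refine Equiv.ext fun ⟨a, b⟩ => ?_
  cases b with
  | false => simp [toSigned, ← hc]
  | true =>
    have := hw (a, false)
    simp only [Bool.not_false] at this
    simp [toSigned, this, ← hc]

lemma IsSignedPerm.symm {w : Equiv.Perm (Fin n × Bool)} (hw : IsSignedPerm w) :
    IsSignedPerm w.symm := by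
  intro p
  rw [Equiv.symm_apply_eq, hw]
  simp

lemma oneLine_fst_lt (w : Equiv.Perm (Fin n × Bool)) {p : ℕ} (hp : p < n) :
    (oneLine w p).1 < n := by
  simp [oneLine, hp]

lemma oneLine_val (w : Equiv.Perm (Fin n × Bool)) (p : Fin n) :
    oneLine w p = ((w (p, false)).1.val, (w (p, false)).2) := by
  simp [oneLine]

lemma sDesPerm_eq_none_iff (w : Equiv.Perm (Fin n × Bool)) {p : ℕ} (hp : p + 1 < n) :
    sDesPerm w p = none ↔ (oneLine w p).2 = (oneLine w (p + 1)).2 ∧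
      (oneLine w p).1 ≤ (oneLine w (p + 1)).1 := by
  have h1 := oneLine_fst_lt w hp
  have h2 := oneLine_fst_lt w (Nat.lt_of_succ_lt hp)
  simp only [sDesPerm, rOrd, hp.ne, hp, if_false, true_and]
  rcases (oneLine w p).2 <;> rcases (oneLine w (p + 1)).2 <;> simp
  omega

lemma sDesPerm_eq_some {w : Equiv.Perm (Fin n × Bool)} {p : ℕ} {b : Bool}
    (h : sDesPerm w p = some b) : (oneLine w p).2 = b := by
  simp only [sDesPerm] at h
  split_ifs at h <;> simpa using h

lemma isSignedSet_sDesPerm (hn : 0 < n) (w : Equiv.Perm (Fin n × Bool)) :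
    IsSignedSet n (sDesPerm w) := by
  refine ⟨by simp [sDesPerm, Nat.sub_add_cancel hn], fun p hp => ?_⟩
  simp [sDesPerm, show p + 1 ≠ n by omega, show ¬ p + 1 < n by omega]

/-- The signed descent set of `w` is refined by `σ`. -/
def Compatible (σ : ℕ → Option Bool) (w : Equiv.Perm (Fin n × Bool)) : Prop :=
  ∀ p < n, (∀ b, σ p = some b → (oneLine w p).2 = b) ∧ (σ p = none → sDesPerm w p = none)

lemma compatible_sDesPerm (w : Equiv.Perm (Fin n × Bool)) : Compatible (sDesPerm w) w :=
  fun _ _ => ⟨fun _ h => sDesPerm_eq_some h, id⟩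

lemma Compatible.color {σ : ℕ → Option Bool} {w : Equiv.Perm (Fin n × Bool)}
    (hσ : IsSignedSet n σ) (h : Compatible σ w) {p : ℕ} (hp : p < n) :
    (oneLine w p).2 = blockColor σ p := by
  obtain ⟨d, hd⟩ : ∃ d, n = p + d + 1 := ⟨n - p - 1, by omega⟩
  induction d generalizing p with
  | zero =>
    obtain ⟨b, hb⟩ := Option.ne_none_iff_exists'.1 hσ.1
    obtain rfl : p = n - 1 := by omega
    rw [(h _ hp).1 b hb, blockColor, hσ.blockEnd_of_ne_none hp hσ.1, hb]
    simp
  | succ d ih =>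
    rcases hb : σ p with _ | b
    · have hp' := hσ.succ_lt hp hb
      have h1 := ((sDesPerm_eq_none_iff w hp').1 ((h p hp).2 hb)).1
      rw [h1, ih hp' (by omega), blockColor, blockColor, hσ.blockEnd_of_eq_none hp hb]
    · rw [(h _ hp).1 b hb, blockColor, hσ.blockEnd_of_ne_none hp (by simp [hb]), hb]
      simp

lemma compatible_toSigned_iff {σ : ℕ → Option Bool} (hσ : IsSignedSet n σ)
    (π : Equiv.Perm (Fin n)) :
    Compatible σ (toSigned (fun a : Fin n => blockColor σ a) π) ↔
      IncrOnFibers (fun p : Fin n => blockEnd σ p) π := by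
  set w := toSigned (fun a : Fin n => blockColor σ a) π with hw
  have hval : ∀ p : Fin n, oneLine w p = ((π p).val, blockColor σ p) := fun p => by
    rw [oneLine_val]; simp [hw, toSigned]
  rw [hσ.incrOnFibers_iff]
  constructor
  · intro h p q hpq hp
    have := ((sDesPerm_eq_none_iff w (hσ.succ_lt p.isLt hp)).1 ((h p p.isLt).2 hp)).2
    rw [← hpq, hval, hval] at this
    refine lt_of_le_of_ne (Fin.le_def.2 this) fun e => ?_
    have := congrArg Fin.val (π.injective e)
    omega
  · intro h p hp
    refine ⟨fun b hb => ?_, fun hb => ?_⟩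
    · rw [hval ⟨p, hp⟩]
      simp [blockColor, hσ.blockEnd_of_ne_none hp (by simp [hb]), hb]
    · have hp' := hσ.succ_lt hp hb
      have := h ⟨p, hp⟩ ⟨p + 1, hp'⟩ rfl hb
      rw [sDesPerm_eq_none_iff w hp', hval ⟨p, hp⟩, hval ⟨p + 1, hp'⟩]
      exact ⟨by simp [blockColor, hσ.blockEnd_of_eq_none hp hb], (Fin.lt_def.1 this).le⟩

lemma toSigned_derangement_iff {σ : ℕ → Option Bool} (hσ : IsSignedSet n σ)
    (π : Equiv.Perm (Fin n)) :
    (∀ q, toSigned (fun a : Fin n => blockColor σ a) π q ≠ q) ↔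
      ∀ a : Fin n, blockEnd σ a ∈ unbarredBlocks n σ → π a ≠ a := by
  simp only [hσ.blockEnd_mem_unbarredBlocks]
  constructor
  · intro h a ha e
    exact h (a, false) (by simp [toSigned, e, ha])
  · rintro h ⟨a, b⟩ e
    simp only [toSigned, Equiv.coe_fn_mk, Prod.mk.injEq] at e
    exact h a (by cases b <;> simpa using e.2) e.1

lemma decreasingUnbarred_toSigned_iff {σ : ℕ → Option Bool} (hσ : IsSignedSet n σ)
    (π : Equiv.Perm (Fin n)) (k : ℕ) :
    DecreasingUnbarred (toSigned (fun a : Fin n => blockColor σ a) π).symm k ↔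
      DecrPrefix (fun p : Fin n => blockEnd σ p) (unbarredBlocks n σ) π.symm k := by
  set w := (toSigned (fun a : Fin n => blockColor σ a) π).symm with hw
  have hval : ∀ p : Fin n, oneLine w p = ((π.symm p).val, blockColor σ (π.symm p)) :=
    fun p => by rw [oneLine_val]; simp [hw, toSigned]
  simp only [DecreasingUnbarred, DecrPrefix, hσ.blockEnd_mem_unbarredBlocks]
  refine and_congr_right fun hk => ?_
  have hcol : (∀ p < k, (oneLine w p).2 = false) ↔
      ∀ p : Fin n, p.val < k → blockColor σ (π.symm p) = false := by
    refine ⟨fun h p hp => ?_, fun h p hp => ?_⟩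
    · simpa [hval] using h p hp
    · rw [hval ⟨p, by omega⟩]
      exact h _ hp
  rw [hcol]
  refine and_congr_right fun hc => ?_
  have hrank : ∀ p : Fin n, p.val < k → rOrd n (oneLine w p) = n + (π.symm p).val :=
    fun p hp => by simp [hval, rOrd, hc p hp]
  constructor
  · intro h p q hpq hq
    obtain ⟨d, hd⟩ : ∃ d, q.val = p.val + d + 1 :=
      ⟨q.val - p.val - 1, by have := Fin.lt_def.1 hpq; omega⟩
    induction d generalizing q with
    | zero =>
      have := h p (by omega)
      rw [show p.val + 1 = q.val by omega, hrank q hq, hrank p (by omega)] at this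
      exact Fin.lt_def.2 (by omega)
    | succ d ih =>
      let z : Fin n := ⟨p.val + d + 1, by omega⟩
      have hz : z.val = p.val + d + 1 := rfl
      have h1 := h z (by omega)
      rw [show z.val + 1 = q.val by omega, hrank q hq, hrank z (by omega)] at h1
      have h2 := ih z (Fin.lt_def.2 (by omega)) (by omega) hz
      exact lt_trans (Fin.lt_def.2 (by omega)) h2
  · intro h p hp
    have := Fin.lt_def.1 (h ⟨p, by omega⟩ ⟨p + 1, by omega⟩ (Fin.lt_def.2 (by simp)) hp)
    rw [hrank ⟨p, by omega⟩ (by simp; omega), hrank ⟨p + 1, by omega⟩ hp]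
    omega

lemma inEB_toSigned_symm_iff {σ : ℕ → Option Bool} (hσ : IsSignedSet n σ)
    (π : Equiv.Perm (Fin n)) :
    InEB (toSigned (fun a : Fin n => blockColor σ a) π).symm ↔
      EvenPrefix (fun p : Fin n => blockEnd σ p) (unbarredBlocks n σ) π.symm := by
  simp only [InEB, EvenPrefix, decreasingUnbarred_toSigned_iff hσ]

lemma ncard_compatible_eq {σ : ℕ → Option Bool} (hσ : IsSignedSet n σ)
    (P : Equiv.Perm (Fin n × Bool) → Prop) :
    {w | (IsSignedPerm w ∧ P w) ∧ Compatible σ w}.ncard =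
      {π | IncrOnFibers (fun p : Fin n => blockEnd σ p) π ∧
        P (toSigned (fun a : Fin n => blockColor σ a) π)}.ncard := by
  rw [← Set.ncard_image_of_injective _ (toSigned_injective fun a : Fin n => blockColor σ a)]
  congr 1
  ext w
  simp only [Set.mem_ofPred_eq, Set.mem_image]
  constructor
  · rintro ⟨⟨h1, h2⟩, h3⟩
    obtain ⟨π, rfl⟩ := exists_toSigned h1 (c := fun a : Fin n => blockColor σ a) fun a => by
      have := h3.color hσ a.isLt
      rwa [oneLine_val] at this
    exact ⟨π, ⟨(compatible_toSigned_iff hσ π).1 h3, h2⟩, rfl⟩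
  · rintro ⟨π, ⟨h1, h2⟩, rfl⟩
    exact ⟨⟨isSignedPerm_toSigned _ _, h2⟩, (compatible_toSigned_iff hσ π).2 h1⟩

lemma ncard_derangements_compatible_eq {σ : ℕ → Option Bool} (hσ : IsSignedSet n σ) :
    {w : Equiv.Perm (Fin n × Bool) |
        (IsSignedPerm w ∧ ∀ q, w q ≠ q) ∧ Compatible σ w}.ncard =
      {w : Equiv.Perm (Fin n × Bool) |
        (IsSignedPerm w ∧ InEB w.symm) ∧ Compatible σ w}.ncard := by
  rw [ncard_compatible_eq hσ fun w => ∀ q, w q ≠ q,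
    ncard_compatible_eq hσ fun w => InEB w.symm]
  simp only [toSigned_derangement_iff hσ, inEB_toSigned_symm_iff hσ]
  exact ncard_fixedPointFree_eq_ncard_evenPrefixed hσ.blockEnd_mono _

lemma compatible_congr (hn : 0 < n) {σ : ℕ → Option Bool} {w v : Equiv.Perm (Fin n × Bool)}
    (h : sDesPerm w = sDesPerm v) : Compatible σ w ↔ Compatible σ v := by
  have hc : ∀ p < n, (oneLine w p).2 = (oneLine v p).2 := fun p hp => by
    rw [(compatible_sDesPerm w).color (isSignedSet_sDesPerm hn w) hp,
      (compatible_sDesPerm v).color (isSignedSet_sDesPerm hn v) hp, h]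
  refine forall₂_congr fun p hp => ?_
  rw [hc p hp, h]

/-- The number of marked positions of `σ`. -/
def markedCard (n : ℕ) (σ : ℕ → Option Bool) : ℕ :=
  ((Finset.range n).filter fun p => σ p ≠ none).card

lemma Compatible.markedCard_lt (hn : 0 < n) {σ : ℕ → Option Bool}
    {w : Equiv.Perm (Fin n × Bool)} (hσ : IsSignedSet n σ) (h : Compatible σ w)
    (hne : sDesPerm w ≠ σ) : markedCard n (sDesPerm w) < markedCard n σ := by
  have hsub : ((Finset.range n).filter fun p => sDesPerm w p ≠ none) ⊆
      (Finset.range n).filter fun p => σ p ≠ none := fun p hp => by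
    simp only [Finset.mem_filter, Finset.mem_range] at hp ⊢
    exact ⟨hp.1, fun e => hp.2 ((h p hp.1).2 e)⟩
  refine Finset.card_lt_card (lt_of_le_of_ne hsub fun e => hne (funext fun p => ?_))
  rcases lt_or_ge p n with hp | hp
  · have hiff := Finset.ext_iff.1 e p
    simp only [Finset.mem_filter, Finset.mem_range, hp, true_and] at hiff
    rcases hb : σ p with _ | b
    · exact (h p hp).2 hb
    · obtain ⟨b', hb'⟩ := Option.ne_none_iff_exists'.1 (hiff.2 (by simp [hb]))
      rw [hb', ← (h p hp).1 b hb, sDesPerm_eq_some hb']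
  · rw [hσ.2 p hp, (isSignedSet_sDesPerm hn w).2 p hp]

/-- Equidistribution of `sDesPerm` follows from that of the compatibility relation. -/
lemma ncard_sDesPerm_eq_of_compatible (hn : 0 < n) {A B : Set (Equiv.Perm (Fin n × Bool))}
    (hAB : ∀ σ, IsSignedSet n σ →
      {w | w ∈ A ∧ Compatible σ w}.ncard = {w | w ∈ B ∧ Compatible σ w}.ncard)
    (σ : ℕ → Option Bool) (hσ : IsSignedSet n σ) :
    {w | w ∈ A ∧ sDesPerm w = σ}.ncard = {w | w ∈ B ∧ sDesPerm w = σ}.ncard := by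
  classical
  obtain ⟨m, hm⟩ : ∃ m, markedCard n σ = m := ⟨_, rfl⟩
  induction m using Nat.strong_induction_on generalizing σ with
  | _ m ih =>
    let T : Finset (ℕ → Option Bool) := insert σ (Finset.univ.image (sDesPerm (n := n)))
    have hsum : ∀ C : Set (Equiv.Perm (Fin n × Bool)),
        {w | w ∈ C ∧ Compatible σ w}.ncard =
          {w | w ∈ C ∧ sDesPerm w = σ}.ncard +
            ∑ τ ∈ T.erase σ, {w | (w ∈ C ∧ Compatible σ w) ∧ sDesPerm w = τ}.ncard := by
      intro C
      have h1 : {w | w ∈ C ∧ sDesPerm w = σ} =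
          {w | (w ∈ C ∧ Compatible σ w) ∧ sDesPerm w = σ} := by
        ext w
        simp only [Set.mem_ofPred_eq]
        exact ⟨fun h => ⟨⟨h.1, h.2 ▸ compatible_sDesPerm w⟩, h.2⟩, fun h => ⟨h.1.1, h.2⟩⟩
      rw [h1, Finset.add_sum_erase T
        (fun τ => {w | (w ∈ C ∧ Compatible σ w) ∧ sDesPerm w = τ}.ncard)
        (Finset.mem_insert_self _ _)]
      have h2 := Finset.card_eq_sum_card_fiberwise (f := sDesPerm)
        (s := Finset.univ.filter fun w => w ∈ C ∧ Compatible σ w) (t := T)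
        (fun w _ => by simp [T])
      simp only [Finset.filter_filter] at h2
      simpa only [Set.ncard_eq_toFinset_card', Set.toFinset_ofPred] using h2
    have hrest : ∀ τ ∈ T.erase σ,
        {w | (w ∈ A ∧ Compatible σ w) ∧ sDesPerm w = τ}.ncard =
          {w | (w ∈ B ∧ Compatible σ w) ∧ sDesPerm w = τ}.ncard := by
      intro τ hτ
      have hτσ := (Finset.mem_erase.1 hτ).1
      by_cases hex : ∃ w : Equiv.Perm (Fin n × Bool), Compatible σ w ∧ sDesPerm w = τ
      · obtain ⟨v, hv, rfl⟩ := hex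
        have hdrop : ∀ C : Set (Equiv.Perm (Fin n × Bool)),
            {w | (w ∈ C ∧ Compatible σ w) ∧ sDesPerm w = sDesPerm v} =
              {w | w ∈ C ∧ sDesPerm w = sDesPerm v} := fun C => by
          ext w
          simp only [Set.mem_ofPred_eq]
          exact ⟨fun h => ⟨h.1.1, h.2⟩,
            fun h => ⟨⟨h.1, (compatible_congr hn h.2).2 hv⟩, h.2⟩⟩
        rw [hdrop, hdrop]
        exact ih _ (hm ▸ hv.markedCard_lt hn hσ hτσ) _ (isSignedSet_sDesPerm hn v) rfl
      · have hempty : ∀ C : Set (Equiv.Perm (Fin n × Bool)),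
            {w | (w ∈ C ∧ Compatible σ w) ∧ sDesPerm w = τ} = ∅ := fun C =>
          Set.eq_empty_of_forall_notMem fun w hw => hex ⟨w, hw.1.2, hw.2⟩
        rw [hempty, hempty]
    have h1 := hsum A
    have h2 := hsum B
    rw [Finset.sum_congr rfl hrest, hAB σ hσ] at h1
    omega

end SignedPerm

/-- For every `n ≥ 1` and every signed set `σ ∈ Σ^B(n)`, the number of derangements
`w ∈ B_n` with `sDes(w) = σ` equals the number of `w ∈ E^B_n` with `sDes(w⁻¹) = σ`. -/
theorem derangements_desarrangements_B (n : ℕ) (hn : 0 < n)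
    (σ : ℕ → Option Bool) (hσ : σ (n - 1) ≠ none ∧ ∀ p, n ≤ p → σ p = none) :
    Set.ncard { w : Equiv.Perm (Fin n × Bool) |
        IsSignedPerm w ∧ (∀ q, w q ≠ q) ∧ sDesPerm w = σ }
      = Set.ncard { w : Equiv.Perm (Fin n × Bool) |
        IsSignedPerm w ∧ InEB w ∧ sDesPerm w.symm = σ } := by
  have h := ncard_sDesPerm_eq_of_compatible hn
    (A := {w | IsSignedPerm w ∧ ∀ q, w q ≠ q}) (B := {w | IsSignedPerm w ∧ InEB w.symm})
    (fun τ hτ => ncard_derangements_compatible_eq hτ) σ hσ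
  simp only [Set.mem_ofPred_eq, and_assoc] at h
  rw [h]
  refine Set.ncard_congr (fun w _ => w.symm) ?_ ?_ ?_
  · exact fun w hw => ⟨hw.1.symm, hw.2.1, hw.2.2⟩
  · exact fun w v _ _ e => Equiv.symm_bijective.injective e
  · exact fun w hw => ⟨w.symm, ⟨hw.1.symm, hw.2.1, hw.2.2⟩, rfl⟩
end
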